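/- arXiv:1401.3143 — 5 statements merged into one kernel-verified Lean document; each statement's English description precedes it below -/
import Mathlib

section
/- For every twice continuously differentiable function f : ℝ → ℂ with compact support contained in (0,∞), the half-Hartley transform H₊f satisfies the upper norm bound ‖H₊f‖_{L²(0,∞)} ≤ 2‖f‖_{L²(0,∞)}. -/
open MeasureTheory Set Filter
open scoped Real

/-- The half-Hartley transform of `f`. -/
noncomputable def halfHartley (f : ℝ → ℂ) (x : ℝ) : ℂ :=
  (Real.sqrt (2 / π) : ℂ) *
    ∫ t in Ioi (0 : ℝ), ((Real.cos (x * t) + Real.sin (x * t) : ℝ) : ℂ) * f t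

open scoped FourierTransform

lemma hh_fourier_int (f : ℝ → ℂ) (hf : ContDiff ℝ 2 f) (hsupp : HasCompactSupport f) :
    Integrable (𝓕 f) := by
  have hfi : Integrable f := hf.continuous.integrable_of_hasCompactSupport hsupp
  have hf1 : ContDiff ℝ 1 (deriv f) := by
    have : ContDiff ℝ (1 + 1) f := by simpa [one_add_one_eq_two] using hf
    exact (contDiff_succ_iff_deriv.1 this).2.2
  have hd1 : Integrable (deriv f) :=
    hf1.continuous.integrable_of_hasCompactSupport hsupp.deriv
  have hd2 : Integrable (deriv (deriv f)) :=
    (hf1.continuous_deriv le_rfl).integrable_of_hasCompactSupport hsupp.deriv.deriv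
  have e1 := Real.fourier_deriv hfi (hf.differentiable (by norm_num)) hd1
  have e2 := Real.fourier_deriv hd1 (hf1.differentiable (by norm_num)) hd2
  have bd : ∀ (g : ℝ → ℂ) (x : ℝ), ‖𝓕 g x‖ ≤ ∫ v, ‖g v‖ := fun g x =>
    VectorFourier.norm_fourierIntegral_le_integral_norm _ _ _ _ _
  have hcont : Continuous (𝓕 f) :=
    VectorFourier.fourierIntegral_continuous Real.continuous_fourierChar
      (by exact continuous_inner) hfi
  refine (((integrable_inv_one_add_sq).const_mul
    ((∫ v, ‖f v‖) + ∫ v, ‖deriv (deriv f) v‖))).mono' hcont.aestronglyMeasurable ?_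
  refine Eventually.of_forall fun x => ?_
  have h1 := bd f x
  have h2 := bd (deriv (deriv f)) x
  rw [e2, e1] at h2
  simp only [norm_mul, Complex.norm_I, Complex.norm_real, Real.norm_eq_abs,
    Complex.norm_ofNat, abs_of_pos Real.pi_pos, mul_one, smul_eq_mul] at h2
  have h3 : 2 * π * |x| * (2 * π * |x| * ‖𝓕 f x‖) = (2 * π) ^ 2 * (x ^ 2 * ‖𝓕 f x‖) := by
    rw [← sq_abs x]; ring
  rw [h3] at h2
  have hp : 1 ≤ (2 * π) ^ 2 := by nlinarith [Real.pi_gt_three]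
  have h4 : x ^ 2 * ‖𝓕 f x‖ ≤ (2 * π) ^ 2 * (x ^ 2 * ‖𝓕 f x‖) :=
    le_mul_of_one_le_left (by positivity) hp
  rw [← div_eq_mul_inv, le_div_iff₀ (by positivity)]
  nlinarith

lemma hh_plancherel (f : ℝ → ℂ) (hc : Continuous f) (hfi : Integrable f)
    (hF : Integrable (𝓕 f)) : ∫ x, ‖𝓕 f x‖ ^ 2 = ∫ x, ‖f x‖ ^ 2 := by
  have key : ∫ ξ, innerSL ℂ (𝓕 f ξ) (𝓕 f ξ) = ∫ x, innerSL ℂ (f x) (𝓕⁻ (𝓕 f) x) := by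
    have h := VectorFourier.integral_sesq_fourierIntegral_eq_neg_flip
      (innerSL ℂ (E := ℂ))
      (L := innerₗ ℝ) Real.continuous_fourierChar continuous_inner hfi hF
    rw [flip_innerₗ] at h
    exact h
  rw [hc.fourierInv_fourier_eq hfi hF] at key
  apply Complex.ofRealLI.injective
  simpa [← LinearIsometry.integral_comp_comm, inner_self_eq_norm_sq_to_K] using key

lemma hh_par (C S : ℂ) :
    ‖C + S‖ ^ 2 ≤ ‖C - Complex.I * S‖ ^ 2 + ‖C + Complex.I * S‖ ^ 2 := by
  simp only [← Complex.normSq_eq_norm_sq, Complex.normSq_apply, Complex.add_re, Complex.add_im,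
    Complex.sub_re, Complex.sub_im, Complex.mul_re, Complex.mul_im, Complex.I_re, Complex.I_im]
  nlinarith [sq_nonneg (C.re - S.re), sq_nonneg (C.im - S.im)]

lemma hh_pointwise (f : ℝ → ℂ) (hc : Continuous f) (hsupp : HasCompactSupport f)
    (hpos : tsupport f ⊆ Ioi (0 : ℝ)) (x : ℝ) :
    ‖halfHartley f x‖ ^ 2 ≤
      2 / π * (‖𝓕 f (x / (2 * π))‖ ^ 2 + ‖𝓕 f (-x / (2 * π))‖ ^ 2) := by
  set C : ℂ := ∫ t, (Real.cos (x * t) : ℂ) * f t with hC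
  set S : ℂ := ∫ t, (Real.sin (x * t) : ℂ) * f t with hS
  have iC : Integrable (fun t => (Real.cos (x * t) : ℂ) * f t) :=
    Continuous.integrable_of_hasCompactSupport (by fun_prop) hsupp.mul_left
  have iS : Integrable (fun t => (Real.sin (x * t) : ℂ) * f t) :=
    Continuous.integrable_of_hasCompactSupport (by fun_prop) hsupp.mul_left
  have hH : halfHartley f x = (Real.sqrt (2 / π) : ℂ) * (C + S) := by
    unfold halfHartley
    rw [setIntegral_eq_integral_of_forall_compl_eq_zero, hC, hS, ← integral_add iC iS]
    · congr 2
      ext t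
      push_cast
      ring
    · intro t ht
      rw [image_eq_zero_of_notMem_tsupport (fun h => ht (hpos h)), mul_zero]
  have h1 : 𝓕 f (x / (2 * π)) = C - Complex.I * S := by
    rw [Real.fourier_real_eq_integral_exp_smul, hC, hS, ← integral_const_mul,
      ← integral_sub iC (iS.const_mul _)]
    congr 1
    ext t
    have : -2 * π * t * (x / (2 * π)) = - (x * t) := by field_simp
    rw [this, Complex.exp_mul_I, ← Complex.ofReal_cos, ← Complex.ofReal_sin, Real.cos_neg,
      Real.sin_neg, smul_eq_mul]
    push_cast
    ring
  have h2 : 𝓕 f (-x / (2 * π)) = C + Complex.I * S := by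
    rw [Real.fourier_real_eq_integral_exp_smul, hC, hS, ← integral_const_mul,
      ← integral_add iC (iS.const_mul _)]
    congr 1
    ext t
    have : -2 * π * t * (-x / (2 * π)) = x * t := by field_simp
    rw [this, Complex.exp_mul_I, ← Complex.ofReal_cos, ← Complex.ofReal_sin, smul_eq_mul]
    ring
  rw [hH, h1, h2, norm_mul, mul_pow, Complex.norm_real, Real.norm_eq_abs, sq_abs,
    Real.sq_sqrt (by positivity)]
  exact mul_le_mul_of_nonneg_left (hh_par C S) (by positivity)

/-- Upper norm bound for the half-Hartley transform of a `C²` function with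
compact support in `(0, ∞)`. -/
theorem halfHartley_L2_upper_bound (f : ℝ → ℂ) (hf : ContDiff ℝ 2 f)
    (hsupp : HasCompactSupport f) (hpos : tsupport f ⊆ Ioi (0 : ℝ)) :
    (∫ x in Ioi (0 : ℝ), ‖halfHartley f x‖ ^ 2) ^ ((1 : ℝ) / 2) ≤
      2 * (∫ x in Ioi (0 : ℝ), ‖f x‖ ^ 2) ^ ((1 : ℝ) / 2) := by
  have hc := hf.continuous
  have hfi : Integrable f := hc.integrable_of_hasCompactSupport hsupp
  have hF := hh_fourier_int f hf hsupp
  have hP := hh_plancherel f hc hfi hF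
  have hcont : Continuous (𝓕 f) :=
    VectorFourier.fourierIntegral_continuous Real.continuous_fourierChar
      (by exact continuous_inner) hfi
  have hF2 : Integrable (fun x => ‖𝓕 f x‖ ^ 2) := by
    have : Integrable (fun x => ‖𝓕 f x‖ * ‖𝓕 f x‖) := by
      refine hF.norm.bdd_mul (c := ∫ v, ‖f v‖) hcont.norm.aestronglyMeasurable
        (Eventually.of_forall fun x => ?_)
      rw [norm_norm]
      exact VectorFourier.norm_fourierIntegral_le_integral_norm _ _ _ _ _
    simpa [sq] using this
  have hG : Integrable (fun x => ‖𝓕 f (x / (2 * π))‖ ^ 2) :=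
    hF2.comp_div (by positivity)
  have hG' : Integrable (fun x => ‖𝓕 f (-x / (2 * π))‖ ^ 2) := hG.comp_neg
  have hsum : (∫ x in Ioi (0 : ℝ), ‖𝓕 f (x / (2 * π))‖ ^ 2)
      + (∫ x in Ioi (0 : ℝ), ‖𝓕 f (-x / (2 * π))‖ ^ 2) = 2 * π * ∫ x, ‖f x‖ ^ 2 := by
    have h1 := integral_comp_neg_Ioi (0 : ℝ) (fun x => ‖𝓕 f (x / (2 * π))‖ ^ 2)
    rw [h1, neg_zero, add_comm, intervalIntegral.integral_Iic_add_Ioi hG.integrableOn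
      hG.integrableOn, Measure.integral_comp_div (fun x => ‖𝓕 f x‖ ^ 2), hP,
      abs_of_pos (by positivity), smul_eq_mul]
  have hfset : ∫ x in Ioi (0 : ℝ), ‖f x‖ ^ 2 = ∫ x, ‖f x‖ ^ 2 := by
    apply setIntegral_eq_integral_of_forall_compl_eq_zero
    intro t ht
    rw [image_eq_zero_of_notMem_tsupport (fun h => ht (hpos h))]
    simp
  have main : ∫ x in Ioi (0 : ℝ), ‖halfHartley f x‖ ^ 2 ≤
      4 * ∫ x in Ioi (0 : ℝ), ‖f x‖ ^ 2 := by
    calc _ ≤ ∫ x in Ioi (0 : ℝ),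
          2 / π * (‖𝓕 f (x / (2 * π))‖ ^ 2 + ‖𝓕 f (-x / (2 * π))‖ ^ 2) := by
          apply integral_mono_of_nonneg
          · exact Eventually.of_forall fun x => by positivity
          · exact ((hG.add hG').const_mul _).integrableOn
          · exact Eventually.of_forall fun x => hh_pointwise f hc hsupp hpos x
      _ = _ := by
          rw [integral_const_mul, integral_add hG.integrableOn hG'.integrableOn, hsum, hfset]
          field_simp
          ring
  rw [← Real.sqrt_eq_rpow, ← Real.sqrt_eq_rpow]
  refine (Real.sqrt_le_sqrt main).trans (le_of_eq ?_)
  rw [Real.sqrt_mul (by norm_num), show (4 : ℝ) = 2 ^ 2 by norm_num,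
    Real.sqrt_sq (by norm_num)]
end

section
/- For every twice continuously differentiable function f : ℝ → ℂ with compact support contained in (0,∞), the following Plancherel-type identity holds: ∫₀^∞ |(H₊f)(x)|² dx = (2/π) ∫_{-∞}^{∞} (cosh²(πτ/2)/cosh(πτ)) |f*(1/2 + iτ)|² dτ, where f* is the Mellin transform of f. -/
open MeasureTheory Set Filter Complex
open scoped Real

open scoped FourierTransform ComplexConjugate ContDiff


lemma fourier_integrable_of_C2 (g : ℝ → ℂ) (hg : ContDiff ℝ 2 g) (hs : HasCompactSupport g) :
    Integrable (𝓕 g) := by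
  have hi : Integrable g := hg.continuous.integrable_of_hasCompactSupport hs
  have hn : ∀ n : ℕ, (n : ℕ∞) ≤ (2 : ℕ∞) → Integrable (iteratedDeriv n g) := by
    intro n hn
    have hcs : HasCompactSupport (iteratedDeriv n g) := by
      clear hn
      induction n with
      | zero => simpa using hs
      | succ n ih => rw [iteratedDeriv_succ]; exact ih.deriv
    refine Continuous.integrable_of_hasCompactSupport ?_ hcs
    exact hg.continuous_iteratedDeriv n (by exact_mod_cast hn)
  have h2 := Real.fourier_iteratedDeriv (N := 2) (n := 2) hg hn le_rfl
  have hc : Continuous (𝓕 g) := by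
    refine VectorFourier.fourierIntegral_continuous Real.continuous_fourierChar ?_ hi
    exact continuous_inner
  have b0 : ∀ x, ‖𝓕 g x‖ ≤ ∫ v, ‖g v‖ := fun x =>
    VectorFourier.norm_fourierIntegral_le_integral_norm _ _ _ _ _
  have b2 : ∀ x, ‖𝓕 (iteratedDeriv 2 g) x‖ ≤ ∫ v, ‖iteratedDeriv 2 g v‖ := fun x =>
    VectorFourier.norm_fourierIntegral_le_integral_norm _ _ _ _ _
  refine Integrable.mono' (integrable_inv_one_add_sq.const_mul
    ((∫ v, ‖g v‖) + (∫ v, ‖iteratedDeriv 2 g v‖))) hc.aestronglyMeasurable (ae_of_all _ fun x => ?_)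
  have h3 := b2 x
  rw [h2] at h3
  simp only [smul_eq_mul, norm_mul, norm_pow, norm_real, norm_I, Complex.norm_ofNat, Real.norm_eq_abs] at h3
  rw [← div_eq_mul_inv, le_div_iff₀ (by positivity)]
  have h4 := b0 x
  have : x ^ 2 ≤ (2 * |π| * 1 * |x|) ^ 2 := by
    rw [← sq_abs x]
    have : (1:ℝ) ≤ 2 * |π| * 1 := by rw [abs_of_pos Real.pi_pos]; linarith [Real.pi_gt_three]
    gcongr
    nlinarith [abs_nonneg x]
  nlinarith [norm_nonneg (𝓕 g x)]

lemma parseval_aux (h g : ℝ → ℂ) (hh : Integrable h) (hc : Continuous g) (hg : Integrable g)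
    (hG : Integrable (𝓕 g)) : ∫ x, h x * conj (g x) = ∫ ξ, 𝓕 h ξ * conj (𝓕 g ξ) := by
  have hinv := hc.fourierInv_fourier_eq hg hG
  have key := VectorFourier.integral_fourierIntegral_smul_eq_flip (μ := (volume : Measure ℝ))
    (ν := (volume : Measure ℝ)) (L := innerₗ ℝ) (f := h) (g := fun ξ => conj (𝓕 g ξ))
    Real.continuous_fourierChar continuous_inner hh ((LinearIsometryEquiv.integrable_comp_iff (Complex.conjLIE)).2 hG)
  simp only [smul_eq_mul, flip_innerₗ] at key
  refine Eq.trans ?_ key.symm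
  congr 1
  ext x
  congr 1
  rw [← hinv]
  conv_lhs => rw [Real.fourierInv_eq, ← integral_conj]
  rw [hinv]
  simp only [VectorFourier.fourierIntegral]
  congr 1
  ext v
  simp [Circle.smul_def, ← Circle.coe_inv_eq_conj, AddChar.map_neg_eq_inv]

lemma conv_lemma (q : ℝ → ℂ) (hq : Integrable q) (hq1 : Integrable (fun s : ℝ => s • q s))
    (hF : Integrable (𝓕 (fun s : ℝ => (s : ℂ) * q s))) :
    ∫ ξ in Iic (0:ℝ), 𝓕 (fun s : ℝ => (s : ℂ) * q s) ξ = I / (2 * π) * ∫ s, q s := by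
  have hd : ∀ ξ, HasDerivAt (fun ξ => I / (2 * π) * 𝓕 q ξ) (𝓕 (fun s : ℝ => (s : ℂ) * q s) ξ) ξ := by
    intro ξ
    have := (Real.hasDerivAt_fourier hq hq1 ξ).const_mul (I / (2 * π))
    convert! this using 1
    have e : (fun x : ℝ => (-2 * π * I * x) • q x) = fun x : ℝ => (-2 * π * I) • ((x:ℂ) * q x) := by
      ext x; simp; ring
    rw [e]
    simp only [Real.fourier_eq, ← integral_const_mul]
    congr 1; ext v
    simp only [Circle.smul_def, smul_eq_mul]
    have : (π : ℂ) ≠ 0 := by exact_mod_cast Real.pi_ne_zero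
    field_simp
    ring_nf
    simp
  have := integral_Iic_of_hasDerivAt_of_tendsto' (a := (0:ℝ)) (m := 0) (fun x _ => hd x) hF.integrableOn ?_
  · rw [this, sub_zero]
    congr 1
    simp [Real.fourier_eq]
  · have h := (Real.zero_at_infty_fourier q).mono_left (atBot_le_cocompact (α := ℝ))
    simpa using h.const_mul (I / (2 * π))

noncomputable def kk (v : ℝ) : ℝ := 1 / (2 * Real.cosh (v / 2))

lemma kk_aux (v : ℝ) (s : ℂ) :
   |Real.sigmoid v * (1 - Real.sigmoid v)| • (((Real.sigmoid v : ℝ) : ℂ) ^ (s - 1) *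
    (1 - ((Real.sigmoid v : ℝ) : ℂ)) ^ ((1 - s) - 1)) = cexp (v * (s - 1/2)) * (kk v : ℂ) := by
  have h0 := Real.sigmoid_pos v
  have h1 : 0 < 1 - Real.sigmoid v := by linarith [Real.sigmoid_lt_one v]
  have hd : 0 < 1 + Real.exp v := by positivity
  have e1 : Real.sigmoid v = Real.exp v / (1 + Real.exp v) := by
    rw [Real.sigmoid_def, Real.exp_neg]; field_simp; ring
  have e2 : 1 - Real.sigmoid v = 1 / (1 + Real.exp v) := by
    rw [e1]; field_simp; ring
  have l1 : Real.log (Real.sigmoid v) = v - Real.log (1 + Real.exp v) := by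
    rw [e1, Real.log_div (by positivity) (by positivity), Real.log_exp]
  have l2 : Real.log (1 - Real.sigmoid v) = - Real.log (1 + Real.exp v) := by
    rw [e2]; simp
  have hk : kk v = Real.exp (v / 2) / (1 + Real.exp v) := by
    have : Real.exp v = Real.exp (v/2) * Real.exp (v/2) := by rw [← Real.exp_add]; ring_nf
    rw [kk, Real.cosh_eq, this, Real.exp_neg]; field_simp
    ring
  have hk2 : kk v = Real.exp (v / 2 - Real.log (1 + Real.exp v)) := by
    rw [hk, Real.exp_sub, Real.exp_log hd]
  rw [abs_of_pos (by positivity), hk2]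
  have e3 : Real.sigmoid v * (1 - Real.sigmoid v) = Real.exp (v - 2 * Real.log (1 + Real.exp v)) := by
    calc _ = Real.exp (Real.log (Real.sigmoid v)) * Real.exp (Real.log (1 - Real.sigmoid v)) := by
          rw [Real.exp_log h0, Real.exp_log h1]
      _ = _ := by rw [l1, l2, ← Real.exp_add]; ring_nf
  rw [e3, ← Complex.ofReal_one, ← Complex.ofReal_sub, cpow_def_of_ne_zero (by exact_mod_cast h0.ne'), cpow_def_of_ne_zero (by exact_mod_cast h1.ne'),
    ← Complex.ofReal_log h0.le, ← Complex.ofReal_log h1.le, l1, l2]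
  rw [Complex.real_smul, Complex.ofReal_exp, Complex.ofReal_exp, ← Complex.exp_add, ← Complex.exp_add, ← Complex.exp_add]
  congr 1
  push_cast
  ring

lemma kk_sub : Integrable (fun v => (kk v : ℂ)) ∧ ∀ ξ : ℝ, 𝓕 (fun v => (kk v : ℂ)) ξ = ((π / Real.cosh (2 * π ^ 2 * ξ) : ℝ) : ℂ) := by
  have hd : ∀ x ∈ (univ : Set ℝ), HasDerivWithinAt Real.sigmoid (Real.sigmoid x * (1 - Real.sigmoid x)) univ x :=
    fun x _ => (Real.hasDerivAt_sigmoid x).hasDerivWithinAt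
  have hinj : InjOn Real.sigmoid univ := Real.sigmoid_injective.injOn
  have him : Real.sigmoid '' univ = Ioo 0 1 := by rw [image_univ, Real.range_sigmoid]
  constructor
  · have h := Complex.betaIntegral_convergent (u := 1/2) (v := 1 - 1/2) (by norm_num) (by norm_num)
    rw [intervalIntegrable_iff_integrableOn_Ioo_of_le zero_le_one, ← him,
      integrableOn_image_iff_integrableOn_abs_deriv_smul MeasurableSet.univ hd hinj] at h
    simp only [kk_aux] at h
    simpa using h
  · intro ξ
    set s : ℂ := 1/2 - 2 * π * ξ * I with hs
    have hs1 : s.re = 1/2 := by simp [hs]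
    have hs2 : (1 - s).re = 1/2 := by rw [Complex.sub_re, hs1]; norm_num
    have h1 := Complex.Gamma_mul_Gamma_eq_betaIntegral (s := s) (t := 1 - s) (by rw [hs1]; norm_num) (by rw [hs2]; norm_num)
    rw [Complex.Gamma_mul_Gamma_one_sub, Complex.betaIntegral, intervalIntegral.integral_of_le zero_le_one,
      integral_Ioc_eq_integral_Ioo, ← him, integral_image_eq_integral_abs_deriv_smul MeasurableSet.univ hd hinj] at h1
    simp only [kk_aux] at h1
    have h2 : Complex.sin (π * s) = Real.cosh (2 * π ^ 2 * ξ) := by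
      rw [hs, show (π:ℂ) * (1/2 - 2 * π * ξ * I) = π/2 - ((2 * π^2 * ξ : ℝ):ℂ) * I by push_cast; ring]
      rw [Complex.sin_pi_div_two_sub, Complex.cos_mul_I]; simp
    rw [h2] at h1
    rw [show s + (1 - s) = 1 by ring, Complex.Gamma_one, one_mul] at h1
    push_cast at h1 ⊢
    rw [h1, Real.fourier_real_eq_integral_exp_smul]
    simp only [Measure.restrict_univ, smul_eq_mul]
    congr 1; ext v; congr 2
    rw [hs]; push_cast; ring

noncomputable def DD (f : ℝ → ℂ) : ℂ := ∫ t, ∫ u, conj (f t) * f u * (((u + t)⁻¹ : ℝ) : ℂ)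

lemma exists_gap (f : ℝ → ℂ) (hpos : tsupport f ⊆ Ioi (0 : ℝ)) : ∃ δ > 0, ∀ t < δ, f t = 0 := by
  have h0 : (tsupport f)ᶜ ∈ nhds (0:ℝ) :=
    (isClosed_tsupport f).isOpen_compl.mem_nhds (fun h => lt_irrefl (0:ℝ) (hpos h))
  obtain ⟨δ, hδ, h⟩ := Metric.mem_nhds_iff.1 h0
  refine ⟨δ, hδ, fun t ht => ?_⟩
  by_contra hne
  have h1 : t ∈ tsupport f := subset_tsupport f hne
  have h2 : 0 < t := hpos h1
  exact h (by simpa [Real.dist_eq, abs_of_pos h2] using ht) h1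

lemma cov_exp (φ : ℝ → ℂ) : ∫ t in Ioi (0:ℝ), φ t = ∫ a : ℝ, (Real.exp (-a) : ℂ) * φ (Real.exp (-a)) := by
  have him : (fun a : ℝ => Real.exp (-a)) '' univ = Ioi 0 := by
    rw [show (fun a : ℝ => Real.exp (-a)) = Real.exp ∘ Neg.neg from rfl, image_comp, image_univ_of_surjective neg_surjective, image_univ, Real.range_exp]
  rw [← him, integral_image_eq_integral_abs_deriv_smul (f' := fun a => -Real.exp (-a)) MeasurableSet.univ
    (fun x _ => by
      have h := ((hasDerivAt_neg x).exp).hasDerivWithinAt (s := univ)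
      rw [mul_neg_one] at h
      exact h)
    (fun x _ y _ h => neg_injective (Real.exp_injective h))]
  simp [abs_of_pos (Real.exp_pos _)]

lemma supp_int (φ : ℝ → ℂ) (h : ∀ t ≤ 0, φ t = 0) : ∫ t, φ t = ∫ t in Ioi (0:ℝ), φ t := by
  rw [setIntegral_eq_integral_of_forall_compl_eq_zero]
  intro x hx
  exact h x (not_lt.1 hx)

noncomputable def gg (f : ℝ → ℂ) (u : ℝ) : ℂ := Real.exp (-(1/2) * u) • f (Real.exp (-u))

lemma kk_sub_eq (a b : ℝ) : Real.exp (-a) * Real.exp (-b) * (Real.exp (-b) + Real.exp (-a))⁻¹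
    = Real.exp (-(1/2) * a) * Real.exp (-(1/2) * b) * kk (a - b) := by
  have e1 : Real.exp (-a) = Real.exp (-(1/2) * a) ^ 2 := by rw [← Real.exp_nat_mul]; ring_nf
  have e2 : Real.exp (-b) = Real.exp (-(1/2) * b) ^ 2 := by rw [← Real.exp_nat_mul]; ring_nf
  have e3 : Real.exp ((a - b) / 2) = Real.exp (-(1/2) * b) / Real.exp (-(1/2) * a) := by
    rw [← Real.exp_sub]; ring_nf
  rw [kk, Real.cosh_eq, Real.exp_neg ((a-b)/2), e1, e2, e3]
  have := Real.exp_pos (-(1/2) * a)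
  have := Real.exp_pos (-(1/2) * b)
  field_simp

lemma DD_eq (f : ℝ → ℂ) (h0 : ∀ t ≤ 0, f t = 0) :
    DD f = ∫ a, ∫ b, conj (gg f a) * gg f b * (kk (a - b) : ℂ) := by
  rw [DD, supp_int _ (fun t ht => by simp [h0 t ht]), cov_exp]
  congr 1; ext a
  rw [supp_int _ (fun t ht => by simp [h0 t ht]), cov_exp, ← integral_const_mul]
  congr 1; ext b
  have := congrArg (fun x : ℝ => (x : ℂ)) (kk_sub_eq a b)
  simp only [gg, Complex.real_smul, map_mul, Complex.conj_ofReal]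
  push_cast at this ⊢
  linear_combination (conj (f (Real.exp (-a))) * f (Real.exp (-b))) * this

lemma norm_gg (f : ℝ → ℂ) (h0 : ∀ t ≤ 0, f t = 0) :
    ∫ a, gg f a * conj (gg f a) = ∫ t, f t * conj (f t) := by
  rw [supp_int (fun t => f t * conj (f t)) (fun t ht => by simp [h0 t ht]), cov_exp]
  congr 1; ext a
  have e1 : Real.exp (-a) = Real.exp (-(1/2) * a) ^ 2 := by rw [← Real.exp_nat_mul]; ring_nf
  have e2 := congrArg (fun x : ℝ => (x : ℂ)) e1
  simp only [gg, Complex.real_smul, map_mul, Complex.conj_ofReal]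
  push_cast at e2 ⊢
  linear_combination (-conj (f (Real.exp (-a))) * f (Real.exp (-a))) * e2

lemma gg_contDiff (f : ℝ → ℂ) (hf : ContDiff ℝ 2 f) : ContDiff ℝ 2 (gg f) := by
  unfold gg
  have : ContDiff ℝ 2 (fun u : ℝ => f (Real.exp (-u))) := hf.comp (Real.contDiff_exp.comp contDiff_neg)
  fun_prop

lemma gg_compact (f : ℝ → ℂ) (hs : HasCompactSupport f) (hpos : tsupport f ⊆ Ioi (0 : ℝ)) :
    HasCompactSupport (gg f) := by
  refine HasCompactSupport.of_support_subset_isCompact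
    (K := (fun t => -Real.log t) '' tsupport f) ?_ ?_
  · refine hs.isCompact.image_of_continuousOn ?_
    exact (Real.continuousOn_log.mono (fun x hx => (ne_of_gt (hpos hx)))).neg
  · intro u hu
    refine ⟨Real.exp (-u), subset_tsupport f ?_, by simp⟩
    intro h
    exact hu (by simp [gg, h])

lemma integral_ofReal_norm_sq (A : ℝ → ℂ) : ∫ x, A x * conj (A x) = ((∫ x, ‖A x‖ ^ 2 : ℝ) : ℂ) := by
  rw [← integral_complex_ofReal]
  congr 1; ext x; rw [Complex.mul_conj, Complex.normSq_eq_norm_sq]; 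

open scoped Convolution in
lemma sech_part (g : ℝ → ℂ) (hc : Continuous g) (hg : Integrable g) (hG : Integrable (𝓕 g)) :
    ∫ a, ∫ b, conj (g a) * g b * (kk (a - b) : ℂ) =
      ((∫ ξ, π / Real.cosh (2 * π ^ 2 * ξ) * ‖𝓕 g ξ‖ ^ 2 : ℝ) : ℂ) := by
  obtain ⟨hk, hkF⟩ := kk_sub
  have hconv := hg.integrable_convolution (ContinuousLinearMap.mul ℂ ℂ) hk
  have hp := parseval_aux _ g hconv hc hg hG
  rw [← integral_complex_ofReal]
  refine Eq.trans (Eq.trans ?_ hp) ?_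
  · congr 1; ext a
    rw [convolution_def, ← integral_mul_const]
    congr 1; ext b
    simp only [ContinuousLinearMap.mul_apply']
    ring
  · congr 1; ext ξ
    rw [Real.fourier_mul_convolution_eq hg hk, hkF]
    push_cast
    rw [← Complex.conj_mul']
    ring

lemma mellin_gg (f : ℝ → ℂ) (τ : ℝ) : mellin f (1 / 2 + τ * Complex.I) = 𝓕 (gg f) (τ / (2 * π)) := by
  rw [mellin_eq_fourier]
  have h1 : (1 / 2 + τ * Complex.I : ℂ).re = 1 / 2 := by simp
  have h2 : (1 / 2 + τ * Complex.I : ℂ).im = τ := by simp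
  rw [h1, h2]
  rfl

lemma fourier_bdd_mul (A B : ℝ → ℂ) (C : ℝ) (hA : ∀ x, ‖A x‖ ≤ C) (hAc : Continuous A) (hB : Integrable B) :
    Integrable (fun x => A x * B x) :=
  hB.bdd_mul hAc.aestronglyMeasurable (ae_of_all _ hA)

lemma fourier_cont (g : ℝ → ℂ) (hi : Integrable g) : Continuous (𝓕 g) := by
  refine VectorFourier.fourierIntegral_continuous Real.continuous_fourierChar ?_ hi
  exact continuous_inner

lemma rhs_eq (f : ℝ → ℂ) (hf : ContDiff ℝ 2 f)
    (hsupp : HasCompactSupport f) (hpos : tsupport f ⊆ Ioi (0 : ℝ)) :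
    (((2 / π) * ∫ τ : ℝ, (Real.cosh (π * τ / 2)) ^ 2 / Real.cosh (π * τ) *
        ‖mellin f (1 / 2 + τ * Complex.I)‖ ^ 2 : ℝ) : ℂ) = 
    2 * (∫ t, f t * conj (f t)) + 2 / π * DD f := by
  obtain ⟨δ, hδ, hgap⟩ := exists_gap f hpos
  have h0 : ∀ t ≤ 0, f t = 0 := fun t ht => hgap t (lt_of_le_of_lt ht hδ)
  have hgc := gg_contDiff f hf
  have hgs := gg_compact f hsupp hpos
  have hgi : Integrable (gg f) := hgc.continuous.integrable_of_hasCompactSupport hgs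
  have hG := fourier_integrable_of_C2 _ hgc hgs
  have hGc := fourier_cont _ hgi
  have hGb : ∀ x, ‖𝓕 (gg f) x‖ ≤ ∫ v, ‖gg f v‖ := fun x =>
    VectorFourier.norm_fourierIntegral_le_integral_norm _ _ _ _ _
  rw [DD_eq f h0, sech_part _ hgc.continuous hgi hG, ← norm_gg f h0,
    parseval_aux _ _ hgi hgc.continuous hgi hG, integral_ofReal_norm_sq]
  norm_cast
  have hi1 : Integrable (fun ξ => ‖𝓕 (gg f) ξ‖ ^ 2) := by
    have := (fourier_bdd_mul _ _ _ hGb hGc hG).norm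
    simpa [sq] using this
  have hi2 : Integrable (fun ξ => π / Real.cosh (2 * π ^ 2 * ξ) * ‖𝓕 (gg f) ξ‖ ^ 2) := by
    refine hi1.bdd_mul (c := π) ?_ (ae_of_all _ fun x => ?_)
    · exact (Continuous.div (by fun_prop) (by fun_prop) (fun x => (Real.cosh_pos _).ne')).aestronglyMeasurable
    · rw [Real.norm_of_nonneg (by have := Real.cosh_pos (2 * π ^ 2 * x); positivity)]
      exact div_le_self Real.pi_pos.le (Real.one_le_cosh _)
  have hsub := Measure.integral_comp_div (fun ξ => (1/2 : ℝ) * ‖𝓕 (gg f) ξ‖ ^ 2 + 1 / (2 * π) * (π / Real.cosh (2 * π ^ 2 * ξ) * ‖𝓕 (gg f) ξ‖ ^ 2)) (2 * π)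
  rw [integral_add (hi1.const_mul _) (hi2.const_mul _), integral_const_mul, integral_const_mul] at hsub
  have hL : ∀ τ : ℝ, (Real.cosh (π * τ / 2)) ^ 2 / Real.cosh (π * τ) *
        ‖mellin f (1 / 2 + τ * Complex.I)‖ ^ 2 = (1/2 : ℝ) * ‖𝓕 (gg f) (τ / (2 * π))‖ ^ 2 + 1 / (2 * π) * (π / Real.cosh (2 * π ^ 2 * (τ / (2 * π))) * ‖𝓕 (gg f) (τ / (2 * π))‖ ^ 2) := by
    intro τ
    rw [mellin_gg]
    have e : 2 * π ^ 2 * (τ / (2 * π)) = π * τ := by field_simp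
    have e2 : Real.cosh (π * τ) = 2 * Real.cosh (π * τ / 2) ^ 2 - 1 := by
      have := Real.cosh_two_mul (π * τ / 2)
      have h3 := Real.cosh_sq (π * τ / 2)
      rw [show 2 * (π * τ / 2) = π * τ by ring] at this
      linarith
    have e3 := (Real.cosh_pos (π * τ)).ne'
    rw [e]
    have e4 : Real.cosh (π * τ / 2) ^ 2 = (Real.cosh (π * τ) + 1) / 2 := by rw [e2]; ring
    rw [e4]
    field_simp
  simp only [hL]
  rw [hsub, abs_of_pos (by positivity), smul_eq_mul]
  field_simp

lemma hartley_eq (f : ℝ → ℂ) (hi : Integrable f) (h0 : ∀ t ≤ 0, f t = 0) (ξ : ℝ) :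
    halfHartley f (2 * π * ξ) = (Real.sqrt (2 / π) : ℂ) * ((1 - I) / 2 * 𝓕 f (-ξ) + (1 + I) / 2 * 𝓕 f ξ) := by
  rw [halfHartley, ← supp_int _ (fun t ht => by simp [h0 t ht])]
  congr 1
  have h1 : ∀ ξ : ℝ, Integrable (fun v : ℝ => cexp (↑(-2 * π * v * ξ) * I) • f v) := by
    intro ξ
    refine hi.bdd_mul (c := 1) (Continuous.aestronglyMeasurable (by fun_prop)) (ae_of_all _ fun x => ?_)
    rw [Complex.norm_exp_ofReal_mul_I]
  rw [Real.fourier_real_eq_integral_exp_smul, Real.fourier_real_eq_integral_exp_smul, ← integral_const_mul,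
    ← integral_const_mul, ← integral_add ((h1 _).const_mul _) ((h1 _).const_mul _)]
  congr 1; ext t
  have e1 : (↑(-2 * π * t * -ξ) : ℂ) * I = ((2 * π * ξ * t : ℝ) : ℂ) * I := by push_cast; ring
  have e2 : (↑(-2 * π * t * ξ) : ℂ) * I = (-((2 * π * ξ * t : ℝ) : ℂ)) * I := by push_cast; ring
  rw [e1, e2, Complex.exp_mul_I, Complex.exp_mul_I, Complex.cos_neg, Complex.sin_neg, ofReal_add, ofReal_cos, ofReal_sin]
  simp only [smul_eq_mul]
  linear_combination (Complex.sin ((2 * π * ξ * t : ℝ) : ℂ) * f t) * I_sq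

lemma norm_sq_aux (a b : ℂ) : ‖(Real.sqrt (2 / π) : ℂ) * ((1 - I) / 2 * a + (1 + I) / 2 * b)‖ ^ 2
    = 2 / π * (1/2 * ‖b‖^2 + 1/2 * ‖a‖^2 + (a * conj b).im) := by
  rw [norm_mul, mul_pow, norm_real, Real.norm_of_nonneg (Real.sqrt_nonneg _), Real.sq_sqrt (by positivity)]
  congr 1
  simp only [← Complex.normSq_eq_norm_sq, Complex.normSq_apply]
  simp
  ring

open scoped Convolution in
lemma cross_part (f : ℝ → ℂ) (hc : Continuous f) (hs : HasCompactSupport f) (hG : Integrable (𝓕 f))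
    (hpos : tsupport f ⊆ Ioi (0 : ℝ)) :
    ∫ ξ in Ioi (0:ℝ), 𝓕 f (-ξ) * conj (𝓕 f ξ) = I / (2 * π) * DD f := by
  obtain ⟨δ, hδ, hgap⟩ := exists_gap f hpos
  have hi : Integrable f := hc.integrable_of_hasCompactSupport hs
  have hci : Integrable (fun t => conj (f t)) := (LinearIsometryEquiv.integrable_comp_iff (Complex.conjLIE)).2 hi
  set p : ℝ → ℂ := (fun t => conj (f t)) ⋆[ContinuousLinearMap.mul ℂ ℂ] f with hp
  have hpi : Integrable p := hci.integrable_convolution (ContinuousLinearMap.mul ℂ ℂ) hi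
  set r : ℝ → ℝ := fun s => (max s δ)⁻¹ with hr
  have hrc : Continuous r := (by fun_prop : Continuous fun s : ℝ => max s δ).inv₀
    (fun s => (lt_of_lt_of_le hδ (le_max_right s δ)).ne')
  have hrb : ∀ s, ‖(r s : ℂ)‖ ≤ δ⁻¹ := by
    intro s
    rw [norm_real, Real.norm_of_nonneg (by positivity)]
    exact inv_anti₀ hδ (le_max_right _ _)
  have hrc' : Continuous (fun s => (r s : ℂ)) := by fun_prop
  have key : ∀ s t : ℝ, conj (f t) * f (s - t) ≠ 0 → 2 * δ ≤ s ∧ δ ≤ t := by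
    intro s t h
    have h1 : δ ≤ t := by
      by_contra! h'
      exact h (by simp [hgap t h'])
    have h2 : δ ≤ s - t := by
      by_contra! h'
      exact h (by simp [hgap _ h'])
    exact ⟨by linarith, h1⟩
  have hpdef : ∀ s, p s = ∫ t, conj (f t) * f (s - t) := by
    intro s; rw [hp, convolution_def]; rfl
  have hp0 : ∀ s < δ, p s = 0 := by
    intro s hs
    rw [hpdef]
    refine integral_eq_zero_of_ae (ae_of_all _ fun t => ?_)
    by_contra h
    have := key s t h
    linarith
  set q : ℝ → ℂ := fun s => (r s : ℂ) * p s with hq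
  have hqi : Integrable q := hpi.bdd_mul hrc'.aestronglyMeasurable (ae_of_all _ hrb)
  have hsq : (fun s : ℝ => (s : ℂ) * q s) = p := by
    ext s
    by_cases h : s < δ
    · simp [hq, hp0 s h]
    · have : r s = s⁻¹ := by simp [hr, max_eq_left (not_lt.1 h)]
      have hs0 : (s : ℂ) ≠ 0 := by
        have : 0 < s := lt_of_lt_of_le hδ (not_lt.1 h)
        exact_mod_cast this.ne'
      simp only [hq, this]
      push_cast
      field_simp
  have hFp : ∀ ξ, 𝓕 p ξ = conj (𝓕 f (-ξ)) * 𝓕 f ξ := by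
    intro ξ
    rw [hp, Real.fourier_mul_convolution_eq hci hi]
    congr 1
    rw [Real.fourier_real_eq_integral_exp_smul, Real.fourier_real_eq_integral_exp_smul, ← integral_conj]
    congr 1; ext v
    simp only [smul_eq_mul, map_mul, ← Complex.exp_conj, Complex.conj_ofReal, Complex.conj_I]
    congr 2; push_cast; ring
  have hGc := fourier_cont _ hi
  have hGb : ∀ x, ‖𝓕 f x‖ ≤ ∫ v, ‖f v‖ := fun x =>
    VectorFourier.norm_fourierIntegral_le_integral_norm _ _ _ _ _
  have hFpi : Integrable (𝓕 p) := by
    rw [show 𝓕 p = fun ξ => conj (𝓕 f (-ξ)) * 𝓕 f ξ from funext hFp]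
    refine fourier_bdd_mul _ _ (∫ v, ‖f v‖) (fun x => by rw [RCLike.norm_conj]; exact hGb _) ?_ hG
    exact Complex.continuous_conj.comp (hGc.comp continuous_neg)
  have h1 := conv_lemma q hqi (by simpa [hsq] using hpi) (by rw [hsq]; exact hFpi)
  rw [hsq] at h1
  have h2 : ∫ ξ in Ioi (0:ℝ), 𝓕 f (-ξ) * conj (𝓕 f ξ) = ∫ ξ in Iic (0:ℝ), 𝓕 p ξ := by
    have := integral_comp_neg_Ioi (0:ℝ) (𝓕 p)
    rw [neg_zero] at this
    rw [← this]
    congr 1; ext ξ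
    rw [hFp, neg_neg, mul_comm]
  rw [h2, h1]
  congr 1
  have h3 : ∀ s, q s = ∫ t, (r s : ℂ) * (conj (f t) * f (s - t)) := by
    intro s
    rw [integral_const_mul, ← hpdef]
  simp only [h3]
  rw [integral_integral_swap]
  · rw [DD]
    congr 1; ext t
    rw [← integral_sub_right_eq_self (fun u => conj (f t) * f u * (((u + t)⁻¹ : ℝ) : ℂ)) t]
    congr 1; ext s
    by_cases h : conj (f t) * f (s - t) = 0
    · simp [h]
    · have h4 := key s t h
      have : r s = s⁻¹ := by simp [hr, max_eq_left (show δ ≤ s by linarith)]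
      rw [this, sub_add_cancel, mul_comm]
  · have h5 := hci.convolution_integrand (ContinuousLinearMap.mul ℂ ℂ) hi
    exact h5.bdd_mul (c := δ⁻¹) (hrc'.comp continuous_fst).aestronglyMeasurable (ae_of_all _ fun x => hrb _)

lemma lhs_eq (f : ℝ → ℂ) (hf : ContDiff ℝ 2 f)
    (hsupp : HasCompactSupport f) (hpos : tsupport f ⊆ Ioi (0 : ℝ)) :
    ∫ x in Ioi (0 : ℝ), ‖halfHartley f x‖ ^ 2 = 2 * (∫ t, f t * conj (f t)).re + 2 / π * (DD f).re := by
  obtain ⟨δ, hδ, hgap⟩ := exists_gap f hpos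
  have h0 : ∀ t ≤ 0, f t = 0 := fun t ht => hgap t (lt_of_le_of_lt ht hδ)
  have hi : Integrable f := hf.continuous.integrable_of_hasCompactSupport hsupp
  have hG := fourier_integrable_of_C2 _ hf hsupp
  have hGc := fourier_cont _ hi
  have hGb : ∀ x, ‖𝓕 f x‖ ≤ ∫ v, ‖f v‖ := fun x =>
    VectorFourier.norm_fourierIntegral_le_integral_norm _ _ _ _ _
  have hi1 : Integrable (fun ξ => ‖𝓕 f ξ‖ ^ 2) := by
    have := (fourier_bdd_mul _ _ _ hGb hGc hG).norm
    simpa [sq] using this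
  have hi2 : Integrable (fun ξ => ‖𝓕 f (-ξ)‖ ^ 2) := hi1.comp_neg
  have hi3 : Integrable (fun ξ => 𝓕 f (-ξ) * conj (𝓕 f ξ)) :=
    fourier_bdd_mul _ _ (∫ v, ‖f v‖) (fun x => hGb _) (hGc.comp continuous_neg)
      ((LinearIsometryEquiv.integrable_comp_iff (Complex.conjLIE)).2 hG)
  have hi4 : Integrable (fun ξ => (𝓕 f (-ξ) * conj (𝓕 f ξ)).im) := hi3.im
  have hi5 : Integrable (fun ξ => 1 / 2 * ‖𝓕 f ξ‖ ^ 2 + 1 / 2 * ‖𝓕 f (-ξ)‖ ^ 2) :=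
    (hi1.const_mul _).add (hi2.const_mul _)
  have hcr := cross_part f hf.continuous hsupp hG hpos
  rw [parseval_aux _ _ hi hf.continuous hi hG, integral_ofReal_norm_sq, ofReal_re]
  have hsub := integral_comp_mul_left_Ioi (fun x => ‖halfHartley f x‖ ^ 2) 0 (show 0 < 2 * π by positivity)
  rw [mul_zero] at hsub
  simp only [hartley_eq f hi h0, norm_sq_aux] at hsub
  rw [integral_const_mul, integral_add hi5.integrableOn hi4.integrableOn,
    integral_add (hi1.const_mul _).integrableOn (hi2.const_mul _).integrableOn, integral_const_mul, integral_const_mul] at hsub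
  have him : ∫ ξ in Ioi (0:ℝ), (𝓕 f (-ξ) * conj (𝓕 f ξ)).im = 1 / (2 * π) * (DD f).re := by
    have : (∫ ξ in Ioi (0:ℝ), 𝓕 f (-ξ) * conj (𝓕 f ξ)).im = ∫ ξ in Ioi (0:ℝ), (𝓕 f (-ξ) * conj (𝓕 f ξ)).im :=
      (integral_im (𝕜 := ℂ) hi3.integrableOn).symm
    rw [← this, hcr, show I / (2 * π) * DD f = ((1 / (2 * π) : ℝ) : ℂ) * (I * DD f) by push_cast; ring, Complex.im_ofReal_mul]
    simp
  have hsum : ∫ ξ, ‖𝓕 f ξ‖ ^ 2 = (∫ ξ in Ioi (0:ℝ), ‖𝓕 f ξ‖ ^ 2) + ∫ ξ in Ioi (0:ℝ), ‖𝓕 f (-ξ)‖ ^ 2 := by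
    have := integral_comp_neg_Ioi (0:ℝ) (fun ξ => ‖𝓕 f ξ‖ ^ 2)
    rw [this, neg_zero, add_comm, intervalIntegral.integral_Iic_add_Ioi hi1.integrableOn hi1.integrableOn]
  rw [him, smul_eq_mul, eq_comm, inv_mul_eq_iff_eq_mul₀ (by positivity)] at hsub
  rw [hsub, hsum]
  field_simp

/-- Plancherel-type identity for the half-Hartley transform of a `C²` function with
compact support in `(0, ∞)`, in terms of the Mellin transform on the critical line. -/
theorem halfHartley_plancherel (f : ℝ → ℂ) (hf : ContDiff ℝ 2 f)
    (hsupp : HasCompactSupport f) (hpos : tsupport f ⊆ Ioi (0 : ℝ)) :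
    ∫ x in Ioi (0 : ℝ), ‖halfHartley f x‖ ^ 2 =
      (2 / π) * ∫ τ : ℝ, (Real.cosh (π * τ / 2)) ^ 2 / Real.cosh (π * τ) *
        ‖mellin f (1 / 2 + τ * Complex.I)‖ ^ 2 := by
  have h := rhs_eq f hf hsupp hpos
  rw [lhs_eq f hf hsupp hpos]
  have h2 := congrArg Complex.re h
  rw [ofReal_re, Complex.add_re, show (2 / π : ℂ) * DD f = ((2 / π : ℝ) : ℂ) * DD f by push_cast; ring,
    Complex.re_ofReal_mul, show (2 : ℂ) = ((2 : ℝ) : ℂ) by norm_num, Complex.re_ofReal_mul] at h2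
  exact h2.symm
end

section
/- For every twice continuously differentiable function f : ℝ → ℂ with compact support contained in (0,∞), the Mellin transform of H₊f on the critical line satisfies the multiplier identity (H₊f)*(s) = √(2/π) Γ(s) [sin(πs/2) + cos(πs/2)] f*(1−s) for every s with Re s = 1/2. -/
open MeasureTheory Set Filter
open scoped Real Topology

lemma hh_intg {q b : ℝ} (hq : -1 < q) (hb : 0 < b) :
    IntegrableOn (fun x : ℝ => x ^ q * Real.exp (-b * x)) (Ioi 0) := by
  have := integrableOn_rpow_mul_exp_neg_mul_rpow (p := 1) hq one_pos hb
  simpa using this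

lemma hh_meas (a r : ℂ) :
    AEStronglyMeasurable (fun x : ℝ => (x : ℂ) ^ a * Complex.exp (-(r * x)))
      (volume.restrict (Ioi 0)) := by
  apply ContinuousOn.aestronglyMeasurable _ measurableSet_Ioi
  intro x hx
  apply ContinuousAt.continuousWithinAt
  apply ContinuousAt.mul
  · exact Complex.continuousAt_ofReal_cpow_const _ _ (Or.inr (ne_of_gt hx))
  · fun_prop

lemma hh_norm (a r : ℂ) {x : ℝ} (hx : 0 < x) :
    ‖(x : ℂ) ^ a * Complex.exp (-(r * x))‖ = x ^ a.re * Real.exp (-r.re * x) := by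
  rw [norm_mul, Complex.norm_cpow_eq_rpow_re_of_pos hx, Complex.norm_exp]
  simp

lemma hh_intC {a r : ℂ} (ha : -1 < a.re) (hr : 0 < r.re) :
    IntegrableOn (fun x : ℝ => (x : ℂ) ^ a * Complex.exp (-(r * x))) (Ioi 0) := by
  refine Integrable.mono' (hh_intg ha hr) (hh_meas a r) ?_
  filter_upwards [ae_restrict_mem measurableSet_Ioi] with x hx
  exact (hh_norm a r hx).le

lemma hh_deriv {s r : ℂ} (hs : 0 < s.re) (hr : 0 < r.re) :
    DifferentiableAt ℂ (fun r : ℂ => ∫ x in Ioi (0:ℝ), (x : ℂ) ^ (s-1) * Complex.exp (-(r * x))) r := by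
  have h := hasDerivAt_integral_of_dominated_loc_of_deriv_le (𝕜 := ℂ)
    (μ := volume.restrict (Ioi (0:ℝ))) (x₀ := r) (s := {z : ℂ | r.re / 2 < z.re})
    (F := fun r x => (x : ℂ) ^ (s-1) * Complex.exp (-(r * x)))
    (F' := fun r x => -((x : ℂ) ^ s * Complex.exp (-(r * x))))
    (bound := fun x => x ^ s.re * Real.exp (-(r.re/2) * x))
    ?_ ?_ ?_ ?_ ?_ ?_ ?_
  · exact h.2.differentiableAt
  · exact (isOpen_lt continuous_const Complex.continuous_re).mem_nhds (by simp; linarith)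
  · exact Eventually.of_forall fun z => hh_meas _ _
  · exact hh_intC (by simp; linarith) hr
  · exact (hh_meas _ _).neg
  · filter_upwards [ae_restrict_mem measurableSet_Ioi] with x hx z hz
    rw [norm_neg, hh_norm _ _ hx]
    have hx' : 0 < x := hx
    have hz' : r.re / 2 < z.re := hz
    gcongr
  · exact hh_intg (by linarith) (by linarith)
  · filter_upwards [ae_restrict_mem measurableSet_Ioi] with x hx z hz
    have hx' : (x : ℂ) ≠ 0 := by exact_mod_cast (ne_of_gt hx)
    have h1 : HasDerivAt (fun z : ℂ => -(z * (x:ℂ))) (-(x:ℂ)) z := by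
      have := ((hasDerivAt_id z).mul_const (x:ℂ)).neg
      rw [one_mul] at this
      exact this
    have h2 := (h1.cexp).const_mul ((x:ℂ)^(s-1))
    have h3 : -((x : ℂ) ^ s * Complex.exp (-(z * x)))
        = (x:ℂ)^(s-1) * (Complex.exp (-(z * x)) * (-(x:ℂ))) := by
      rw [Complex.cpow_sub _ _ hx', Complex.cpow_one]
      field_simp
    rw [h3]
    exact h2

lemma hh_gamma {s r : ℂ} (hs : 0 < s.re) (hr : 0 < r.re) :
    ∫ x in Ioi (0:ℝ), (x : ℂ) ^ (s-1) * Complex.exp (-(r * x)) = r ^ (-s) * Complex.Gamma s := by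
  have hU : IsOpen {z : ℂ | 0 < z.re} := isOpen_lt continuous_const Complex.continuous_re
  have hA : AnalyticOnNhd ℂ (fun r : ℂ => ∫ x in Ioi (0:ℝ), (x : ℂ) ^ (s-1) * Complex.exp (-(r * x)))
      {z : ℂ | 0 < z.re} :=
    DifferentiableOn.analyticOnNhd (fun z hz => (hh_deriv hs hz).differentiableWithinAt) hU
  have hB : AnalyticOnNhd ℂ (fun r : ℂ => r ^ (-s) * Complex.Gamma s) {z : ℂ | 0 < z.re} := by
    refine DifferentiableOn.analyticOnNhd (fun z hz => ?_) hU
    refine DifferentiableAt.differentiableWithinAt ?_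
    refine DifferentiableAt.mul_const ?_ _
    exact (differentiableAt_id).cpow_const (Or.inl hz)
  refine hA.eqOn_of_preconnected_of_frequently_eq hB
    (convex_halfSpace_re_gt 0).isPreconnected (z₀ := 1) (by simp) ?_ hr
  have ht : Tendsto (fun n : ℕ => (((1 + 1 / ((n:ℝ) + 1) : ℝ)) : ℂ)) atTop (𝓝[≠] (1:ℂ)) := by
    rw [tendsto_nhdsWithin_iff]
    constructor
    · have := (tendsto_one_div_add_atTop_nhds_zero_nat (𝕜 := ℝ)).const_add 1
      have h2 := (Complex.continuous_ofReal.tendsto _).comp this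
      simpa [Function.comp_def] using h2
    · refine Eventually.of_forall fun n => ?_
      have : (1:ℝ) + 1 / ((n:ℝ) + 1) ≠ 1 := by
        have : 0 < 1 / ((n:ℝ) + 1) := by positivity
        linarith
      simp only [mem_compl_iff, mem_singleton_iff]
      exact_mod_cast this
  refine ht.frequently (Eventually.of_forall fun n => ?_).frequently
  have hp : (0:ℝ) < 1 + 1 / ((n:ℝ) + 1) := by positivity
  rw [Complex.integral_cpow_mul_exp_neg_mul_Ioi hs hp]
  congr 1
  rw [one_div, Complex.inv_cpow, Complex.cpow_neg]
  rw [Complex.arg_ofReal_of_nonneg hp.le]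
  exact Real.pi_pos.ne

/-- Integration by parts against an exponential. -/
lemma hh_ibp {g : ℝ → ℂ} (hg : ContDiff ℝ 1 g) (hc : HasCompactSupport g) (k : ℂ) :
    ∫ t : ℝ, Complex.exp (k * t) * deriv g t = - (k * ∫ t : ℝ, Complex.exp (k * t) * g t) := by
  have hd : HasCompactSupport (deriv g) := hc.deriv
  have hcd : Continuous (deriv g) := hg.continuous_deriv le_rfl
  have hgc := hg.continuous
  have h := integral_mul_deriv_eq_deriv_mul_of_integrable
    (u := fun t : ℝ => Complex.exp (k * t)) (u' := fun t : ℝ => k * Complex.exp (k * t))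
    (v := g) (v' := deriv g) ?_ ?_ ?_ ?_ ?_
  · rw [h, ← integral_const_mul]
    simp only [mul_assoc]
  · intro t _
    have h1 : HasDerivAt (fun t : ℝ => k * (t:ℂ)) k t := by
      simpa using (Complex.ofRealCLM.hasDerivAt (x := t)).const_mul k
    simpa [mul_comm] using h1.cexp
  · intro t _
    exact (hg.differentiable one_ne_zero t).hasDerivAt
  · exact (Continuous.integrable_of_hasCompactSupport (by fun_prop) hd.mul_left)
  · exact (Continuous.integrable_of_hasCompactSupport (by fun_prop) hc.mul_left)
  · exact (Continuous.integrable_of_hasCompactSupport (by fun_prop) hc.mul_left)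

lemma hh_decay {f : ℝ → ℂ} (hf : ContDiff ℝ 2 f) (hc : HasCompactSupport f) {c : ℂ} (h0 : c.re = 0)
    (h1 : ‖c‖ = 1) : ∃ A : ℝ, 0 ≤ A ∧ ∀ x : ℝ, ‖∫ t : ℝ, Complex.exp (c * x * t) * f t‖ ≤ A ∧
      x ^ 2 * ‖∫ t : ℝ, Complex.exp (c * x * t) * f t‖ ≤ A := by
  have hn (x t : ℝ) : ‖Complex.exp (c * x * t)‖ = 1 := by
    rw [Complex.norm_exp]; simp [h0]
  have hb (g : ℝ → ℂ) (x : ℝ) : ‖∫ t : ℝ, Complex.exp (c * x * t) * g t‖ ≤ ∫ t, ‖g t‖ := by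
    refine (norm_integral_le_integral_norm _).trans_eq ?_
    simp [hn]
  have hf1 : ContDiff ℝ 1 (deriv f) := by
    have : ContDiff ℝ (1+1) f := by simpa [one_add_one_eq_two] using hf
    exact (contDiff_succ_iff_deriv.1 this).2.2
  refine ⟨max (∫ t, ‖f t‖) (∫ t, ‖deriv (deriv f) t‖), ?_, fun x => ⟨(hb f x).trans (le_max_left _ _), ?_⟩⟩
  · exact le_max_of_le_left (integral_nonneg fun _ => norm_nonneg _)
  · refine le_trans (le_of_eq ?_) ((hb (deriv (deriv f)) x).trans (le_max_right _ _))
    rw [hh_ibp hf1 hc.deriv, hh_ibp (hf.of_le (by norm_num)) hc]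
    simp only [norm_neg, norm_mul, h1, one_mul, Complex.norm_real, Real.norm_eq_abs]
    rw [← sq_abs x]
    ring

lemma hh_cont {f : ℝ → ℂ} (hf : Continuous f) (hc : HasCompactSupport f) {c : ℂ} (h0 : c.re = 0) :
    Continuous (fun x : ℝ => ∫ t : ℝ, Complex.exp (c * x * t) * f t) := by
  refine continuous_of_dominated (bound := fun t => ‖f t‖) ?_ ?_ ?_ ?_
  · intro x
    exact Continuous.aestronglyMeasurable (by fun_prop)
  · intro x
    refine Eventually.of_forall fun t => ?_
    rw [norm_mul, Complex.norm_exp]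
    simp [h0]
  · exact (hf.integrable_of_hasCompactSupport hc).norm
  · exact Eventually.of_forall fun t => by fun_prop

lemma hh_int1 {f : ℝ → ℂ} (hf : ContDiff ℝ 2 f) (hc : HasCompactSupport f) {c : ℂ} (h0 : c.re = 0)
    (h1 : ‖c‖ = 1) {s : ℂ} (hs : s.re = 1 / 2) :
    IntegrableOn (fun x : ℝ => (∫ t : ℝ, Complex.exp (c * x * t) * f t) * (x : ℂ) ^ (s - 1))
      (Ioi 0) := by
  obtain ⟨A, hA, hd⟩ := hh_decay hf hc h0 h1
  have hm : ContinuousOn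
      (fun x : ℝ => (∫ t : ℝ, Complex.exp (c * x * t) * f t) * (x : ℂ) ^ (s - 1)) (Ioi 0) := by
    refine (hh_cont hf.continuous hc h0).continuousOn.mul ?_
    intro x hx
    exact (Complex.continuousAt_ofReal_cpow_const _ _ (Or.inr (ne_of_gt hx))).continuousWithinAt
  have hre : (s - 1).re = -1/2 := by simp [hs]; norm_num
  rw [← Ioc_union_Ioi_eq_Ioi (zero_le_one' ℝ)]
  refine IntegrableOn.union ?_ ?_
  · have hi : IntegrableOn (fun x : ℝ => A * x ^ (-1/2 : ℝ)) (Ioc 0 1) := by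
      have := intervalIntegral.intervalIntegrable_rpow' (a := 0) (b := 1) (r := -1/2) (by norm_num)
      exact ((intervalIntegrable_iff_integrableOn_Ioc_of_le zero_le_one).1 this).const_mul A
    refine Integrable.mono' hi
      ((hm.mono Ioc_subset_Ioi_self).aestronglyMeasurable measurableSet_Ioc) ?_
    filter_upwards [ae_restrict_mem measurableSet_Ioc] with x hx
    rw [norm_mul, Complex.norm_cpow_eq_rpow_re_of_pos hx.1, hre]
    exact mul_le_mul_of_nonneg_right (hd x).1 (Real.rpow_nonneg hx.1.le _)
  · have hi : IntegrableOn (fun x : ℝ => A * x ^ (-5/2 : ℝ)) (Ioi 1) :=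
      (integrableOn_Ioi_rpow_of_lt (by norm_num) one_pos).const_mul A
    refine Integrable.mono' hi
      ((hm.mono (Ioi_subset_Ioi zero_le_one)).aestronglyMeasurable measurableSet_Ioi) ?_
    filter_upwards [ae_restrict_mem measurableSet_Ioi] with x hx
    have hx0 : 0 < x := lt_trans one_pos hx
    rw [norm_mul, Complex.norm_cpow_eq_rpow_re_of_pos hx0, hre]
    have : x ^ (-1/2 : ℝ) = x ^ 2 * x ^ (-5/2 : ℝ) := by
      rw [← Real.rpow_natCast, ← Real.rpow_add hx0]; norm_num
    rw [this, ← mul_assoc, mul_comm _ (x^2)]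
    exact mul_le_mul_of_nonneg_right (hd x).2 (Real.rpow_nonneg hx0.le _)

lemma hh_lim1 {F : ℝ → ℂ} (hF : IntegrableOn F (Ioi 0)) :
    Tendsto (fun ε : ℝ => ∫ x in Ioi (0:ℝ), F x * Complex.exp (-(ε * x))) (𝓝[>] 0)
      (𝓝 (∫ x in Ioi (0:ℝ), F x)) := by
  refine tendsto_integral_filter_of_dominated_convergence (fun x => ‖F x‖) ?_ ?_ hF.norm ?_
  · refine Eventually.of_forall fun ε => ?_
    exact hF.aestronglyMeasurable.mul (Continuous.aestronglyMeasurable (by fun_prop))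
  · filter_upwards [self_mem_nhdsWithin] with ε hε
    filter_upwards [ae_restrict_mem measurableSet_Ioi] with x hx
    rw [norm_mul, Complex.norm_exp]
    have : 0 < ε * x := mul_pos hε hx
    refine mul_le_of_le_one_right (norm_nonneg _) ?_
    rw [Real.exp_le_one_iff]
    simp
    exact this.le
  · refine Eventually.of_forall fun x => ?_
    have : ContinuousAt (fun ε : ℝ => F x * Complex.exp (-(ε * x))) 0 := by fun_prop
    have h2 := this.tendsto
    simp at h2
    exact h2.mono_left nhdsWithin_le_nhds

lemma hh_fubini {f : ℝ → ℂ} (hf : Continuous f) (hc : HasCompactSupport f) {c : ℂ}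
    (h0 : c.re = 0) {s : ℂ} (hs : 0 < s.re) {ε : ℝ} (hε : 0 < ε) :
    ∫ x in Ioi (0:ℝ), (∫ t : ℝ, Complex.exp (c * x * t) * f t) * (x : ℂ) ^ (s - 1)
        * Complex.exp (-(ε * x))
      = ∫ t : ℝ, f t * ((ε - c * t) ^ (-s) * Complex.Gamma s) := by
  have hfi := hf.integrable_of_hasCompactSupport hc (μ := volume)
  have hgi : IntegrableOn (fun x : ℝ => (x : ℂ) ^ (s-1) * Complex.exp (-((ε:ℂ) * x))) (Ioi 0) :=
    hh_intC (by simp; linarith) (by simpa using hε)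
  have hprod : Integrable (Function.uncurry fun (x t : ℝ) => Complex.exp (c * x * t) *
      (((x : ℂ) ^ (s-1) * Complex.exp (-((ε:ℂ) * x))) * f t))
      ((volume.restrict (Ioi (0:ℝ))).prod volume) := by
    refine Integrable.bdd_mul (c := 1) (Integrable.mul_prod hgi hfi) ?_ ?_
    · exact Continuous.aestronglyMeasurable (by fun_prop)
    · refine Eventually.of_forall fun p => ?_
      rw [Complex.norm_exp]
      simp [h0]
  calc _ = ∫ x in Ioi (0:ℝ), ∫ t : ℝ, Complex.exp (c * x * t) *
      (((x : ℂ) ^ (s-1) * Complex.exp (-((ε:ℂ) * x))) * f t) := by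
        congr 1
        ext x
        rw [mul_assoc, ← integral_mul_const]
        congr 1
        ext t
        ring
    _ = ∫ t : ℝ, ∫ x in Ioi (0:ℝ), Complex.exp (c * x * t) *
      (((x : ℂ) ^ (s-1) * Complex.exp (-((ε:ℂ) * x))) * f t) := integral_integral_swap hprod
    _ = _ := by
        congr 1
        ext t
        rw [← hh_gamma hs (r := ε - c * t) (by simp [h0, hε]), ← integral_const_mul]
        congr 1
        ext x
        have : Complex.exp (-((ε - c * t) * x))
            = Complex.exp (c * x * t) * Complex.exp (-((ε:ℂ) * x)) := by
          rw [← Complex.exp_add]; congr 1; ring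
        rw [this]
        ring

lemma hh_im {c : ℂ} (h0 : c.re = 0) (h1 : ‖c‖ = 1) : |c.im| = 1 := by
  rw [← h1, Complex.abs_im_eq_norm.2 h0]

lemma hh_lim2 {f : ℝ → ℂ} (hf : Continuous f) (hc : HasCompactSupport f)
    (hpos : tsupport f ⊆ Ioi (0 : ℝ)) {c : ℂ}
    (h0 : c.re = 0) (h1 : ‖c‖ = 1) {s : ℂ} (hs : s.re = 1 / 2) :
    Tendsto (fun ε : ℝ => ∫ t : ℝ, f t * ((ε - c * t) ^ (-s) * Complex.Gamma s)) (𝓝[>] 0)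
      (𝓝 (∫ t : ℝ, f t * ((- c * t) ^ (-s) * Complex.Gamma s))) := by
  obtain ⟨a, ha, hfa⟩ : ∃ a : ℝ, 0 < a ∧ ∀ t, f t ≠ 0 → a ≤ t := by
    rcases (tsupport f).eq_empty_or_nonempty with he | hne
    · refine ⟨1, one_pos, fun t ht => ?_⟩
      have := subset_tsupport f ht
      simp [he] at this
    · obtain ⟨a, ha, hm⟩ := hc.isCompact.exists_isLeast hne
      exact ⟨a, hpos ha, fun t ht => hm (subset_tsupport f ht)⟩
  have him := hh_im h0 h1
  refine tendsto_integral_filter_of_dominated_convergence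
    (fun t => ‖f t‖ * (a ^ (-(1/2) : ℝ) * Real.exp (π * |s.im|) * ‖Complex.Gamma s‖)) ?_ ?_ ?_ ?_
  · filter_upwards [self_mem_nhdsWithin] with ε hε
    refine Continuous.aestronglyMeasurable (hf.mul (Continuous.mul ?_ continuous_const))
    refine Continuous.cpow (by fun_prop) continuous_const fun t => Or.inl ?_
    have : 0 < ε := hε
    simpa [h0] using this
  · filter_upwards [self_mem_nhdsWithin] with ε hε
    refine Eventually.of_forall fun t => ?_
    by_cases hft : f t = 0
    · simp [hft]
    have hat := hfa t hft
    have hε' : 0 < ε := hε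
    rw [norm_mul, norm_mul]
    have hw : ((ε:ℂ) - c * t) ≠ 0 := by
      intro h
      have := congrArg Complex.re h
      simp [h0] at this
      exact hε'.ne' this
    have hn : a ≤ ‖(ε:ℂ) - c * t‖ := by
      refine le_trans ?_ (Complex.abs_im_le_norm _)
      simp [abs_mul, him]
      exact hat.trans (le_abs_self t)
    gcongr
    rw [Complex.norm_cpow_of_ne_zero hw, div_eq_mul_inv, ← Real.exp_neg]
    have hre : (-s).re = -(1/2) := by simp [hs]
    rw [hre]
    gcongr ?_ * ?_
    · exact Real.rpow_le_rpow_of_nonpos ha hn (by norm_num)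
    · refine Real.exp_le_exp.2 ?_
      refine (le_abs_self _).trans ?_
      rw [abs_neg, abs_mul, Complex.neg_im, abs_neg]
      exact mul_le_mul_of_nonneg_right (Complex.abs_arg_le_pi _) (abs_nonneg _)
  · exact (hf.integrable_of_hasCompactSupport hc).norm.mul_const _
  · refine Eventually.of_forall fun t => ?_
    by_cases hft : f t = 0
    · simp [hft]
    have hat : 0 < t := ha.trans_le (hfa t hft)
    refine Tendsto.const_mul _ (Tendsto.mul_const _ ?_)
    have : ContinuousAt (fun ε : ℝ => ((ε:ℂ) - c * t) ^ (-s)) 0 := by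
      refine ContinuousAt.cpow (by fun_prop) continuousAt_const (Or.inr ?_)
      have : c.im ≠ 0 := by intro h; simp [h] at him
      simp [this, hat.ne']
    have h2 := this.tendsto
    simp only [Complex.ofReal_zero, zero_sub, ← neg_mul] at h2
    exact h2.mono_left nhdsWithin_le_nhds

lemma hh_zero {f : ℝ → ℂ} (hpos : tsupport f ⊆ Ioi (0 : ℝ)) (g : ℝ → ℂ) :
    ∫ t in Ioi (0:ℝ), g t * f t = ∫ t, g t * f t := by
  refine setIntegral_eq_integral_of_forall_compl_eq_zero fun x hx => ?_
  rw [image_eq_zero_of_notMem_tsupport (fun h => hx (hpos h)), mul_zero]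

lemma hh_main {f : ℝ → ℂ} (hf : ContDiff ℝ 2 f) (hc : HasCompactSupport f)
    (hpos : tsupport f ⊆ Ioi (0 : ℝ)) {c : ℂ}
    (h0 : c.re = 0) (h1 : ‖c‖ = 1) {s : ℂ} (hs : s.re = 1 / 2) :
    ∫ x in Ioi (0:ℝ), (∫ t : ℝ, Complex.exp (c * x * t) * f t) * (x : ℂ) ^ (s - 1)
      = Complex.Gamma s * (-c) ^ (-s) * mellin f (1 - s) := by
  have hl := hh_lim1 (hh_int1 hf hc h0 h1 hs)
  have hr := hh_lim2 hf.continuous hc hpos h0 h1 hs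
  have := tendsto_nhds_unique (hl.congr' ?_) hr
  · rw [this, mellin, ← integral_const_mul]
    simp only [mul_comm (f _), smul_eq_mul, ← mul_assoc]
    rw [← hh_zero hpos]
    refine setIntegral_congr_fun measurableSet_Ioi fun t ht => ?_
    have ht' : (0:ℝ) < t := ht
    have hc0 : -c ≠ 0 := by intro h; rw [neg_eq_zero.1 h] at h1; simp at h1
    have htc : (t:ℂ) ≠ 0 := by exact_mod_cast ht'.ne'
    have : (-c * t) ^ (-s) = (-c) ^ (-s) * (t:ℂ) ^ (1 - s - 1) := by
      rw [show 1 - s - 1 = -s by ring, mul_comm (-c), Complex.cpow_def_of_ne_zero (mul_ne_zero htc hc0),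
        Complex.cpow_def_of_ne_zero hc0, Complex.cpow_def_of_ne_zero htc,
        Complex.log_ofReal_mul ht' hc0, ← Complex.exp_add, Complex.ofReal_log ht'.le]
      congr 1; ring
    simp only [this]
    ring
  · filter_upwards [self_mem_nhdsWithin] with ε hε
    exact hh_fubini hf.continuous hc h0 (by rw [hs]; norm_num) hε

/-- Mellin multiplier identity for the half-Hartley transform on the critical line:
the Mellin transform of `H₊f` at `s` (as an improper integral) equals
`√(2/π) Γ(s) [sin(πs/2) + cos(πs/2)] f*(1-s)`. -/
theorem halfHartley_mellin_multiplier (f : ℝ → ℂ) (hf : ContDiff ℝ 2 f)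
    (hsupp : HasCompactSupport f) (hpos : tsupport f ⊆ Ioi (0 : ℝ))
    (s : ℂ) (hs : s.re = 1 / 2) :
    Tendsto (fun R : ℝ => ∫ t in Ioc (0 : ℝ) R, halfHartley f t * (t : ℂ) ^ (s - 1))
      atTop
      (𝓝 ((Real.sqrt (2 / π) : ℂ) * Complex.Gamma s *
        (Complex.sin (π * s / 2) + Complex.cos (π * s / 2)) * mellin f (1 - s))) := by
  have hI0 : Complex.I.re = 0 := by simp
  have hI1 : ‖Complex.I‖ = 1 := by simp
  have hJ0 : (-Complex.I).re = 0 := by simp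
  have hJ1 : ‖-Complex.I‖ = 1 := by simp
  have hfi (c : ℂ) (x : ℝ) : Integrable (fun t : ℝ => Complex.exp (c * x * t) * f t) := by
    have := hf.continuous
    exact Continuous.integrable_of_hasCompactSupport (by fun_prop) hsupp.mul_left
  have hH (x : ℝ) : halfHartley f x = (Real.sqrt (2 / π) : ℂ) *
      ((1 - Complex.I) / 2 * (∫ t : ℝ, Complex.exp (Complex.I * x * t) * f t)
        + (1 + Complex.I) / 2 * (∫ t : ℝ, Complex.exp (-Complex.I * x * t) * f t)) := by
    rw [halfHartley, hh_zero hpos, ← integral_const_mul ((1 - Complex.I) / 2),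
      ← integral_const_mul ((1 + Complex.I) / 2),
      ← integral_add ((hfi _ _).const_mul _) ((hfi _ _).const_mul _)]
    congr 2
    ext t
    push_cast
    rw [show Complex.I * x * t = ((x * t : ℂ)) * Complex.I by ring,
      show -Complex.I * x * t = (-(x * t : ℂ)) * Complex.I by ring,
      Complex.exp_mul_I, Complex.exp_mul_I, Complex.cos_neg, Complex.sin_neg]
    linear_combination (Complex.sin (x * t) * f t) * Complex.I_sq
  have hi1 := (hh_int1 hf hsupp hI0 hI1 hs).const_mul
    ((Real.sqrt (2 / π) : ℂ) * ((1 - Complex.I) / 2))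
  have hi2 := (hh_int1 hf hsupp hJ0 hJ1 hs).const_mul
    ((Real.sqrt (2 / π) : ℂ) * ((1 + Complex.I) / 2))
  have hfun : (fun t : ℝ => halfHartley f t * (t : ℂ) ^ (s - 1)) = fun x : ℝ =>
      (Real.sqrt (2 / π) : ℂ) * ((1 - Complex.I) / 2) *
        ((∫ t : ℝ, Complex.exp (Complex.I * x * t) * f t) * (x : ℂ) ^ (s - 1)) +
      (Real.sqrt (2 / π) : ℂ) * ((1 + Complex.I) / 2) *
        ((∫ t : ℝ, Complex.exp (-Complex.I * x * t) * f t) * (x : ℂ) ^ (s - 1)) := by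
    ext x
    rw [hH]
    ring
  have hint : IntegrableOn (fun t : ℝ => halfHartley f t * (t : ℂ) ^ (s - 1)) (Ioi 0) := by
    rw [hfun]; exact hi1.add hi2
  have hval : ∫ t in Ioi (0:ℝ), halfHartley f t * (t : ℂ) ^ (s - 1) =
      (Real.sqrt (2 / π) : ℂ) * Complex.Gamma s *
        (Complex.sin (π * s / 2) + Complex.cos (π * s / 2)) * mellin f (1 - s) := by
    rw [hfun, integral_add hi1 hi2, integral_const_mul, integral_const_mul,
      hh_main hf hsupp hpos hI0 hI1 hs, hh_main hf hsupp hpos hJ0 hJ1 hs, neg_neg,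
      Complex.cpow_def_of_ne_zero (neg_ne_zero.2 Complex.I_ne_zero),
      Complex.cpow_def_of_ne_zero Complex.I_ne_zero, Complex.log_I, Complex.log_neg_I,
      show -(π / 2 : ℂ) * Complex.I * -s = (π * s / 2) * Complex.I by ring,
      show (π / 2 : ℂ) * Complex.I * -s = (-(π * s / 2)) * Complex.I by ring,
      Complex.exp_mul_I, Complex.exp_mul_I, Complex.cos_neg, Complex.sin_neg]
    linear_combination (-(Real.sqrt (2 / π) : ℂ) * Complex.Gamma s * Complex.sin (π * s / 2)
      * mellin f (1 - s)) * Complex.I_sq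
  rw [← hval]
  refine (intervalIntegral_tendsto_integral_Ioi 0 hint tendsto_id).congr' ?_
  filter_upwards [eventually_ge_atTop 0] with R hR
  exact intervalIntegral.integral_of_le hR
end

section
/- Inversion formula for the half-Hartley transform: for every twice continuously differentiable f : ℝ → ℂ with compact support in (0,∞), writing h = H₊f, the truncated integrals F_N(x) = √(2/π) ∫₀^N [sin(xt) S(xt) + cos(xt) C(xt)] h(t) dt converge to f in the L²(0,∞) norm as N → ∞. -/
open MeasureTheory Set Filter
open scoped Real Topology

/-- The Fresnel sine integral `S(x) = √(2/π) ∫₀^{√x} sin(t²) dt`. -/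
noncomputable def fresnelS (x : ℝ) : ℝ :=
  Real.sqrt (2 / π) * ∫ t in (0 : ℝ)..Real.sqrt x, Real.sin (t ^ 2)

/-- The Fresnel cosine integral `C(x) = √(2/π) ∫₀^{√x} cos(t²) dt`. -/
noncomputable def fresnelC (x : ℝ) : ℝ :=
  Real.sqrt (2 / π) * ∫ t in (0 : ℝ)..Real.sqrt x, Real.cos (t ^ 2)


lemma hh_int0 : Integrable (fun w : ℝ => 1 / (1 + w ^ 4)) := by
  refine (integrable_inv_one_add_sq.const_mul 2).mono' ?_ ?_
  · exact (Continuous.div continuous_const (by fun_prop) (fun x => by positivity)).aestronglyMeasurable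
  · refine Eventually.of_forall fun x => ?_
    rw [Real.norm_of_nonneg (by positivity), ← div_eq_mul_inv, div_le_div_iff₀ (by positivity) (by positivity)]
    nlinarith [sq_nonneg (x ^ 2 - 1)]

lemma hh_int2 : Integrable (fun w : ℝ => w ^ 2 / (1 + w ^ 4)) := by
  refine (integrable_inv_one_add_sq.const_mul 2).mono' ?_ ?_
  · exact (Continuous.div (by fun_prop) (by fun_prop) (fun x => by positivity)).aestronglyMeasurable
  · refine Eventually.of_forall fun x => ?_
    rw [Real.norm_of_nonneg (by positivity), ← div_eq_mul_inv, div_le_div_iff₀ (by positivity) (by positivity)]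
    nlinarith [sq_nonneg (x ^ 2 - 1)]

lemma hh_quad (w : ℝ) : 0 < w ^ 2 + √2 * w + 1 := by
  nlinarith [sq_nonneg (w + √2 / 2), Real.sq_sqrt (show (0:ℝ) ≤ 2 by norm_num)]

lemma hh_quad' (w : ℝ) : 0 < w ^ 2 - √2 * w + 1 := by
  nlinarith [sq_nonneg (w - √2 / 2), Real.sq_sqrt (show (0:ℝ) ≤ 2 by norm_num)]

lemma hh_quad_mul (w : ℝ) : 1 + w ^ 4 = (w ^ 2 + √2 * w + 1) * (w ^ 2 - √2 * w + 1) := by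
  linear_combination (w ^ 2) * Real.sq_sqrt (show (0:ℝ) ≤ 2 by norm_num)

lemma hh_sum : ∫ w in Ioi (0:ℝ), (1 / (1 + w ^ 4) + w ^ 2 / (1 + w ^ 4)) = π / √2 := by
  have h2 := Real.sq_sqrt (show (0:ℝ) ≤ 2 by norm_num)
  have h2p : (0:ℝ) < √2 := by positivity
  have hd : ∀ x ∈ Ioi (0:ℝ), HasDerivAt
      (fun w : ℝ => (1 / √2) * (Real.arctan (√2 * w + 1) + Real.arctan (√2 * w - 1)))
      (1 / (1 + x ^ 4) + x ^ 2 / (1 + x ^ 4)) x := by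
    intro x _
    have e1 : HasDerivAt (fun w : ℝ => √2 * w + 1) √2 x := by
      simpa using ((hasDerivAt_id x).const_mul √2).add_const 1
    have e2 : HasDerivAt (fun w : ℝ => √2 * w - 1) √2 x := by
      simpa using ((hasDerivAt_id x).const_mul √2).sub_const 1
    have := (e1.arctan.add e2.arctan).const_mul (1 / √2)
    refine HasDerivAt.congr_deriv this ?_
    have a1 : 1 + (√2 * x + 1) ^ 2 = 2 * (x ^ 2 + √2 * x + 1) := by linear_combination x^2 * h2
    have a2 : 1 + (√2 * x - 1) ^ 2 = 2 * (x ^ 2 - √2 * x + 1) := by linear_combination x^2 * h2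
    rw [a1, a2, hh_quad_mul]
    have p1 := hh_quad x
    have p2 := hh_quad' x
    have p3 : 1 + x ^ 2 = ((x ^ 2 + √2 * x + 1) + (x ^ 2 - √2 * x + 1)) / 2 := by ring
    rw [← add_div, p3]
    generalize x ^ 2 + √2 * x + 1 = P at *
    generalize x ^ 2 - √2 * x + 1 = Q at *
    field_simp
    ring
  have := integral_Ioi_of_hasDerivAt_of_tendsto (a := (0:ℝ)) (m := π / √2) (f := fun w : ℝ => (1 / √2) * (Real.arctan (√2 * w + 1) + Real.arctan (√2 * w - 1)))
    (by apply Continuous.continuousWithinAt; fun_prop) hd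
    ((hh_int0.add hh_int2).integrableOn) ?_
  · rw [this]; simp [Real.arctan_neg]
  · have l1 : Tendsto (fun w : ℝ => √2 * w + 1) atTop atTop :=
      tendsto_atTop_add_const_right _ _ (tendsto_id.const_mul_atTop h2p)
    have l2 : Tendsto (fun w : ℝ => √2 * w - 1) atTop atTop :=
      tendsto_atTop_add_const_right _ _ (tendsto_id.const_mul_atTop h2p)
    have t := tendsto_nhds_of_tendsto_nhdsWithin Real.tendsto_arctan_atTop
    have := ((t.comp l1).add (t.comp l2)).const_mul (1 / √2)
    rw [show π / √2 = 1 / √2 * (π / 2 + π / 2) by ring]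
    exact this

lemma hh_diff : ∫ w in Ioi (0:ℝ), (1 / (1 + w ^ 4) - w ^ 2 / (1 + w ^ 4)) = 0 := by
  have h2 := Real.sq_sqrt (show (0:ℝ) ≤ 2 by norm_num)
  have h2p : (0:ℝ) < √2 := by positivity
  have hd : ∀ x : ℝ, HasDerivAt
      (fun w : ℝ => (1 / (2 * √2)) * (Real.log ((w ^ 2 + √2 * w + 1) / (w ^ 2 - √2 * w + 1))))
      (1 / (1 + x ^ 4) - x ^ 2 / (1 + x ^ 4)) x := by
    intro x
    have e1 : HasDerivAt (fun w : ℝ => w ^ 2 + √2 * w + 1) (2 * x + √2) x := by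
      simpa using (((hasDerivAt_id x).pow 2).add ((hasDerivAt_id x).const_mul √2)).add_const 1
    have e2 : HasDerivAt (fun w : ℝ => w ^ 2 - √2 * w + 1) (2 * x - √2) x := by
      simpa using (((hasDerivAt_id x).pow 2).sub ((hasDerivAt_id x).const_mul √2)).add_const 1
    have p1 := hh_quad x
    have p2 := hh_quad' x
    have := ((e1.div e2 p2.ne').log (by simp only [Pi.div_apply]; positivity)).const_mul (1 / (2 * √2))
    refine HasDerivAt.congr_deriv this ?_
    rw [hh_quad_mul]
    simp only [Pi.div_apply]
    field_simp
    ring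
  have := integral_Ioi_of_hasDerivAt_of_tendsto (a := (0:ℝ)) (m := 0) 
    (f := (fun w : ℝ => (1 / (2 * √2)) * (Real.log ((w ^ 2 + √2 * w + 1) / (w ^ 2 - √2 * w + 1)))))
    (hd 0).continuousAt.continuousWithinAt (fun x _ => hd x)
    ((hh_int0.sub hh_int2).integrableOn) ?_
  · rw [this]; simp
  · have ti : Tendsto (fun w : ℝ => w⁻¹) atTop (𝓝 0) := tendsto_inv_atTop_zero
    have n1 : Tendsto (fun w : ℝ => 1 + √2 * w⁻¹ + w⁻¹ ^ 2) atTop (𝓝 1) := by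
      simpa using (ti.const_mul √2).const_add 1 |>.add (ti.pow 2)
    have n2 : Tendsto (fun w : ℝ => 1 - √2 * w⁻¹ + w⁻¹ ^ 2) atTop (𝓝 1) := by
      simpa using (ti.const_mul √2).const_sub 1 |>.add (ti.pow 2)
    have := ((n1.div n2 one_ne_zero).log (by simp)).const_mul (1 / (2 * √2))
    simp only [div_one, Real.log_one, mul_zero] at this
    refine this.congr' ?_
    filter_upwards [eventually_gt_atTop 0] with w hw
    simp only [Pi.div_apply]
    congr 2
    rw [← mul_div_mul_left _ _ (show w ^ 2 ≠ 0 by positivity)]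
    congr 1 <;> field_simp

lemma hh_M0 : ∫ w in Ioi (0:ℝ), 1 / (1 + w ^ 4) = π / (2 * √2) := by
  have a := hh_sum
  have b := hh_diff
  rw [integral_add hh_int0.integrableOn hh_int2.integrableOn] at a
  rw [integral_sub hh_int0.integrableOn hh_int2.integrableOn] at b
  have : π / (2 * √2) = π / √2 / 2 := by field_simp
  linarith

lemma hh_M2 : ∫ w in Ioi (0:ℝ), w ^ 2 / (1 + w ^ 4) = π / (2 * √2) := by
  have a := hh_sum
  have b := hh_diff
  rw [integral_add hh_int0.integrableOn hh_int2.integrableOn] at a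
  rw [integral_sub hh_int0.integrableOn hh_int2.integrableOn] at b
  have : π / (2 * √2) = π / √2 / 2 := by field_simp
  linarith

lemma hh_int0b (b : ℝ) (hb : 0 < b) : IntegrableOn (fun w : ℝ => 1 / (b ^ 4 + w ^ 4)) (Ioi 0) := by
  have : Integrable (fun w : ℝ => b⁻¹ ^ 4 * (1 / (1 + (b⁻¹ * w) ^ 4))) :=
    (hh_int0.comp_mul_left' (inv_ne_zero hb.ne')).const_mul _
  refine this.integrableOn.congr_fun (fun w _ => ?_) measurableSet_Ioi
  simp only []
  field_simp

lemma hh_int2b (b : ℝ) (hb : 0 < b) : IntegrableOn (fun w : ℝ => w ^ 2 / (b ^ 4 + w ^ 4)) (Ioi 0) := by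
  have : Integrable (fun w : ℝ => b⁻¹ ^ 2 * ((b⁻¹ * w) ^ 2 / (1 + (b⁻¹ * w) ^ 4))) :=
    (hh_int2.comp_mul_left' (inv_ne_zero hb.ne')).const_mul _
  refine this.integrableOn.congr_fun (fun w _ => ?_) measurableSet_Ioi
  simp only []
  field_simp

lemma hh_M0b (b : ℝ) (hb : 0 < b) :
    ∫ w in Ioi (0:ℝ), 1 / (b ^ 4 + w ^ 4) = π / (2 * √2) / b ^ 3 := by
  have := integral_comp_mul_left_Ioi (fun w : ℝ => 1 / (1 + w ^ 4)) 0 (inv_pos.2 hb)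
  rw [mul_zero, hh_M0, inv_inv, smul_eq_mul] at this
  have e : ∀ w : ℝ, 1 / (b ^ 4 + w ^ 4) = b⁻¹ ^ 4 * (1 / (1 + (b⁻¹ * w) ^ 4)) := by
    intro w; field_simp
  simp_rw [e]
  rw [integral_const_mul, this]
  field_simp

lemma hh_M2b (b : ℝ) (hb : 0 < b) :
    ∫ w in Ioi (0:ℝ), w ^ 2 / (b ^ 4 + w ^ 4) = π / (2 * √2) / b := by
  have := integral_comp_mul_left_Ioi (fun w : ℝ => w ^ 2 / (1 + w ^ 4)) 0 (inv_pos.2 hb)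
  rw [mul_zero, hh_M2, inv_inv, smul_eq_mul] at this
  have e : ∀ w : ℝ, w ^ 2 / (b ^ 4 + w ^ 4) = b⁻¹ ^ 2 * ((b⁻¹ * w) ^ 2 / (1 + (b⁻¹ * w) ^ 4)) := by
    intro w; field_simp
  simp_rw [e]
  rw [integral_const_mul, this]
  field_simp

/-- The key rational integral. -/
lemma hh_key (x s : ℝ) (hx : 0 < x) (hs : 0 < s) (hne : s ≠ x) :
    ∫ w in Ioi (0:ℝ), w ^ 2 / (1 + w ^ 4) * ((w ^ 2 * x + s) / ((w ^ 2 * x) ^ 2 + s ^ 2))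
      = π / (2 * √2) / (x + s) := by
  obtain ⟨b, hb, rfl⟩ : ∃ b : ℝ, 0 < b ∧ s = x * b ^ 2 :=
    ⟨√(s / x), by positivity, by rw [Real.sq_sqrt (by positivity)]; field_simp⟩
  have hb1 : b ^ 4 - 1 ≠ 0 := by
    intro h
    apply hne
    have : (b ^ 2 - 1) * (b ^ 2 + 1) = 0 := by linear_combination h
    rcases mul_eq_zero.1 this with h | h
    · rw [show b ^ 2 = 1 by linarith, mul_one]
    · nlinarith [sq_nonneg b]
  have e : ∀ w : ℝ, w ^ 2 / (1 + w ^ 4) * ((w ^ 2 * x + x * b ^ 2) / ((w ^ 2 * x) ^ 2 + (x * b ^ 2) ^ 2))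
      = (1 / (x * (b ^ 4 - 1))) * ((b ^ 2 * (w ^ 2 / (1 + w ^ 4)) - 1 / (1 + w ^ 4)) +
        (b ^ 4 * (1 / (b ^ 4 + w ^ 4)) - b ^ 2 * (w ^ 2 / (b ^ 4 + w ^ 4)))) := by
    intro w
    have h1 : 1 + w ^ 4 ≠ 0 := by positivity
    have h2 : b ^ 4 + w ^ 4 ≠ 0 := by positivity
    have h3 : (w ^ 2 * x) ^ 2 + (x * b ^ 2) ^ 2 = x ^ 2 * (b ^ 4 + w ^ 4) := by ring
    rw [h3]
    field_simp
    ring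
  simp_rw [e]
  rw [integral_const_mul, integral_add, integral_sub, integral_sub, integral_const_mul,
    integral_const_mul, integral_const_mul, hh_M0, hh_M2, hh_M0b b hb, hh_M2b b hb]
  · have : b ^ 2 + 1 ≠ 0 := by positivity
    have h3 : x + x * b ^ 2 ≠ 0 := by positivity
    have h4 : x * (1 + b ^ 2) ≠ 0 := by positivity
    rw [show x + x * b ^ 2 = x * (1 + b ^ 2) by ring]
    field_simp
    ring
  · exact (hh_int0b b hb).const_mul _
  · exact (hh_int2b b hb).const_mul _
  · exact hh_int2.integrableOn.const_mul _
  · exact hh_int0.integrableOn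
  · exact (hh_int2.integrableOn.const_mul _).sub hh_int0.integrableOn
  · exact ((hh_int0b b hb).const_mul _).sub ((hh_int2b b hb).const_mul _)

lemma hh_ne (w : ℝ) : ((w : ℂ) ^ 2 - Complex.I) ≠ 0 := by
  intro h
  have := congrArg Complex.im h
  simp [← Complex.ofReal_pow] at this

lemma hh_fres (v : ℝ) (hv : 0 ≤ v) :
    (√π : ℂ) * ∫ t in (0:ℝ)..v, Complex.exp (Complex.I * (t:ℂ) ^ 2) =
      ∫ w in Ioi (0:ℝ), (1 - Complex.exp (-((w:ℂ) ^ 2 - Complex.I) * (v:ℂ) ^ 2)) /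
        ((w:ℂ) ^ 2 - Complex.I) := by
  let F : ℝ → ℝ → ℂ := fun t w => 2 * (t:ℂ) * Complex.exp (-((w:ℂ) ^ 2 - Complex.I) * (t:ℂ) ^ 2)
  have hFn : ∀ t w : ℝ, 0 < t → ‖F t w‖ = 2 * t * Real.exp (-t ^ 2 * w ^ 2) := by
    intro t w ht
    simp only [F, norm_mul, Complex.norm_exp, Complex.norm_real, Real.norm_of_nonneg ht.le,
      Complex.norm_ofNat]
    congr 2
    simp [← Complex.ofReal_pow]
    ring
  have hint : ∀ t : ℝ, 0 < t → ∫ w in Ioi (0:ℝ), Real.exp (-t ^ 2 * w ^ 2) = √π / (2 * t) := by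
    intro t ht
    rw [integral_gaussian_Ioi (t ^ 2), Real.sqrt_div Real.pi_pos.le, Real.sqrt_sq ht.le]
    field_simp
  have hI : Integrable (Function.uncurry F)
      ((volume.restrict (Ioc 0 v)).prod (volume.restrict (Ioi (0:ℝ)))) := by
    rw [integrable_prod_iff]
    · constructor
      · filter_upwards [ae_restrict_mem measurableSet_Ioc] with t ht
        have : Integrable (fun w : ℝ => 2 * t * Real.exp (-t ^ 2 * w ^ 2)) :=
          (integrable_exp_neg_mul_sq (pow_pos ht.1 2)).const_mul _
        refine this.integrableOn.mono' ?_ ?_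
        · exact Continuous.aestronglyMeasurable (by simp only [Function.uncurry, F]; fun_prop)
        · exact Eventually.of_forall fun w => (hFn t w ht.1).le
      · have : IntegrableOn (fun _ : ℝ => √π) (Ioc 0 v) := by simp
        refine this.congr_fun (fun t ht => ?_) measurableSet_Ioc
        simp only [Function.uncurry]
        simp_rw [fun w => hFn t w ht.1]
        rw [integral_const_mul, hint t ht.1]
        have := ht.1
        field_simp
    · exact Continuous.aestronglyMeasurable (by simp only [Function.uncurry_def, F]; fun_prop)
  have hsw := integral_integral_swap hI
  have h1 : ∫ t in Ioc 0 v, ∫ w in Ioi (0:ℝ), F t w =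
      (√π : ℂ) * ∫ t in (0:ℝ)..v, Complex.exp (Complex.I * (t:ℂ) ^ 2) := by
    rw [intervalIntegral.integral_of_le hv, ← integral_const_mul]
    refine setIntegral_congr_fun measurableSet_Ioc fun t ht => ?_
    have e : ∀ w : ℝ, F t w = (2 * (t:ℂ) * Complex.exp (Complex.I * (t:ℂ) ^ 2)) *
        ((Real.exp (-t ^ 2 * w ^ 2) : ℝ) : ℂ) := by
      intro w
      simp only [F]
      rw [Complex.ofReal_exp, mul_assoc (2 * (t:ℂ)), ← Complex.exp_add]
      congr 2
      push_cast
      ring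
    simp_rw [e]
    rw [integral_const_mul, integral_complex_ofReal, hint t ht.1]
    have : (t:ℂ) ≠ 0 := by exact_mod_cast ht.1.ne'
    push_cast
    field_simp
  have h2 : ∀ w : ℝ, ∫ t in Ioc 0 v, F t w =
      (1 - Complex.exp (-((w:ℂ) ^ 2 - Complex.I) * (v:ℂ) ^ 2)) / ((w:ℂ) ^ 2 - Complex.I) := by
    intro w
    rw [← intervalIntegral.integral_of_le hv]
    have hd : ∀ t ∈ uIcc 0 v, HasDerivAt
        (fun t : ℝ => -(Complex.exp (-((w:ℂ) ^ 2 - Complex.I) * (t:ℂ) ^ 2) / ((w:ℂ) ^ 2 - Complex.I)))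
        (F t w) t := by
      intro t _
      have e0 : HasDerivAt (fun z : ℂ => -(Complex.exp (-((w:ℂ) ^ 2 - Complex.I) * z ^ 2) / ((w:ℂ) ^ 2 - Complex.I)))
        (F t w) (t:ℂ) := by
        have := (((((hasDerivAt_id (t:ℂ)).pow 2).const_mul (-((w:ℂ) ^ 2 - Complex.I))).cexp).div_const
          ((w:ℂ) ^ 2 - Complex.I)).neg
        refine HasDerivAt.congr_deriv this ?_
        have := hh_ne w
        simp [F]
        field_simp
        ring
      exact e0.comp_ofReal
    rw [intervalIntegral.integral_eq_sub_of_hasDerivAt hd]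
    · simp; ring
    · exact Continuous.intervalIntegrable (by simp only [F]; fun_prop) _ _
  rw [← h1, hsw]
  simp_rw [h2]

noncomputable def hhk (y : ℝ) : ℝ := Real.sin y * fresnelS y + Real.cos y * fresnelC y
noncomputable def hhK (y : ℝ) : ℝ := Real.sin y * fresnelC y - Real.cos y * fresnelS y
noncomputable def hhr (y : ℝ) : ℝ :=
  ∫ w in Ioi (0:ℝ), w ^ 2 / (1 + w ^ 4) * Real.exp (-(w ^ 2 * y))

lemma hh_fresC (y : ℝ) : (fresnelC y : ℂ) + Complex.I * fresnelS y =
    (√(2 / π) : ℂ) * ∫ t in (0:ℝ)..√y, Complex.exp (Complex.I * (t:ℂ) ^ 2) := by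
  have e : ∀ t : ℝ, Complex.exp (Complex.I * (t:ℂ) ^ 2) =
      ((Real.cos (t ^ 2) : ℝ) : ℂ) + Complex.I * ((Real.sin (t ^ 2) : ℝ) : ℂ) := by
    intro t
    rw [mul_comm, ← Complex.ofReal_pow, Complex.exp_mul_I]
    push_cast
    ring
  simp_rw [e]
  rw [intervalIntegral.integral_add, intervalIntegral.integral_const_mul,
    intervalIntegral.integral_ofReal, intervalIntegral.integral_ofReal, fresnelC, fresnelS]
  · push_cast
    ring
  · exact Continuous.intervalIntegrable (by fun_prop) _ _
  · exact Continuous.intervalIntegrable (by fun_prop) _ _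

lemma hh_inv (w : ℝ) : 1 / ((w : ℂ) ^ 2 - Complex.I) =
    ((w ^ 2 / (1 + w ^ 4) : ℝ) : ℂ) + ((1 / (1 + w ^ 4) : ℝ) : ℂ) * Complex.I := by
  have h := hh_ne w
  have h2 : (1 + (w:ℂ) ^ 4) ≠ 0 := by
    have : (1 + w ^ 4) ≠ 0 := by positivity
    exact_mod_cast this
  push_cast
  rw [div_eq_iff h]
  field_simp
  linear_combination (Complex.I_sq)

lemma hh_W (y : ℝ) (hy : 0 ≤ y) : ((hhk y : ℝ) : ℂ) - Complex.I * hhK y =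
    ((√2 / π : ℝ) : ℂ) * ∫ w in Ioi (0:ℝ), (Complex.exp (-(Complex.I * y)) - ((Real.exp (-(w ^ 2 * y)) : ℝ) : ℂ)) *
      (((w ^ 2 / (1 + w ^ 4) : ℝ) : ℂ) + ((1 / (1 + w ^ 4) : ℝ) : ℂ) * Complex.I) := by
  have h1 : ((hhk y : ℝ) : ℂ) - Complex.I * hhK y =
      Complex.exp (-(Complex.I * y)) * ((fresnelC y : ℂ) + Complex.I * fresnelS y) := by
    rw [show -(Complex.I * y) = ((-y : ℝ) : ℂ) * Complex.I by push_cast; ring, Complex.exp_mul_I,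
      ← Complex.ofReal_cos, ← Complex.ofReal_sin, Real.cos_neg, Real.sin_neg, hhk, hhK]
    push_cast
    linear_combination (Complex.sin y * fresnelS y) * Complex.I_sq
  have hc : (√(2 / π) : ℂ) = ((√2 / π : ℝ) : ℂ) * (√π : ℂ) := by
    rw [← Complex.ofReal_mul]
    congr 1
    rw [Real.sqrt_div (by norm_num)]
    have := Real.sq_sqrt Real.pi_pos.le
    have h3 : √π ≠ 0 := by positivity
    field_simp
    linear_combination - this
  rw [h1, hh_fresC, hc, mul_assoc ((√2 / π : ℝ) : ℂ), hh_fres _ (Real.sqrt_nonneg _),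
    mul_left_comm, ← integral_const_mul]
  congr 1
  refine integral_congr_ae (Eventually.of_forall fun w => ?_)
  simp only []
  rw [← hh_inv, ← Complex.ofReal_pow (√y), Real.sq_sqrt hy, mul_one_div, ← mul_div_assoc, mul_sub, ← Complex.exp_add,
    mul_one, Complex.ofReal_exp]
  congr 3
  push_cast
  ring_nf

lemma hh_intC_s6 : Integrable (fun w : ℝ => 
    (((w ^ 2 / (1 + w ^ 4) : ℝ) : ℂ) + ((1 / (1 + w ^ 4) : ℝ) : ℂ) * Complex.I)) (volume.restrict (Ioi 0)) :=
  (hh_int2.integrableOn.ofReal).add (hh_int0.integrableOn.ofReal.mul_const _)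

lemma hh_exp_le (w y : ℝ) (hy : 0 ≤ y) : Real.exp (-(w ^ 2 * y)) ≤ 1 := by
  rw [Real.exp_le_one_iff]
  have : 0 ≤ w ^ 2 * y := by positivity
  linarith

lemma hh_bd : ∃ C : ℝ, 0 < C ∧ ∀ y : ℝ, 0 ≤ y → |hhk y| ≤ C ∧ |hhK y| ≤ C := by
  refine ⟨√2 / π * ∫ w in Ioi (0:ℝ), 2 * (w ^ 2 / (1 + w ^ 4) + 1 / (1 + w ^ 4)), ?_, fun y hy => ?_⟩
  · rw [integral_const_mul, integral_add hh_int2.integrableOn hh_int0.integrableOn, hh_M0, hh_M2]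
    positivity
  have h : ‖((hhk y : ℝ) : ℂ) - Complex.I * hhK y‖ ≤
      √2 / π * ∫ w in Ioi (0:ℝ), 2 * (w ^ 2 / (1 + w ^ 4) + 1 / (1 + w ^ 4)) := by
    rw [hh_W y hy, norm_mul, Complex.norm_real, Real.norm_of_nonneg (by positivity)]
    gcongr
    refine norm_integral_le_of_norm_le ((hh_int2.add hh_int0).const_mul 2).integrableOn ?_
    refine Eventually.of_forall fun w => ?_
    rw [norm_mul]
    gcongr
    · refine (norm_sub_le _ _).trans ?_
      rw [Complex.norm_real, Real.norm_of_nonneg (Real.exp_pos _).le, Complex.norm_exp]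
      have := hh_exp_le w y hy
      simp
      linarith
    · refine (norm_add_le _ _).trans ?_
      rw [norm_mul, Complex.norm_real, Complex.norm_real, Complex.norm_I, mul_one,
        Real.norm_of_nonneg (by positivity), Real.norm_of_nonneg (by positivity)]
  constructor
  · refine le_trans ?_ h
    simpa using Complex.abs_re_le_norm (((hhk y : ℝ) : ℂ) - Complex.I * hhK y)
  · refine le_trans ?_ h
    simpa using Complex.abs_im_le_norm (((hhk y : ℝ) : ℂ) - Complex.I * hhK y)

lemma hh_k_eq (y : ℝ) (hy : 0 ≤ y) :
    hhk y = (Real.cos y + Real.sin y) / 2 - √2 / π * hhr y := by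
  have hi : Integrable (fun w : ℝ => ((Real.exp (-(w ^ 2 * y)) : ℝ) : ℂ) *
      (((w ^ 2 / (1 + w ^ 4) : ℝ) : ℂ) + ((1 / (1 + w ^ 4) : ℝ) : ℂ) * Complex.I)) (volume.restrict (Ioi 0)) := by
    refine hh_intC_s6.bdd_mul (c := 1) (Continuous.aestronglyMeasurable (by fun_prop)) ?_
    refine Eventually.of_forall fun w => ?_
    rw [Complex.norm_real, Real.norm_of_nonneg (Real.exp_pos _).le]
    exact hh_exp_le w y hy
  have h := hh_W y hy
  simp_rw [sub_mul (Complex.exp _)] at h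
  rw [integral_sub (hh_intC_s6.const_mul _) hi, integral_const_mul,
    integral_add hh_int2.integrableOn.ofReal (hh_int0.integrableOn.ofReal.mul_const _), integral_mul_const,
    integral_complex_ofReal, integral_complex_ofReal, hh_M0, hh_M2] at h
  have h2 := congrArg Complex.re h
  have h3 : (∫ w in Ioi (0:ℝ), ((Real.exp (-(w ^ 2 * y)) : ℝ) : ℂ) *
      (((w ^ 2 / (1 + w ^ 4) : ℝ) : ℂ) + ((1 / (1 + w ^ 4) : ℝ) : ℂ) * Complex.I)).re = hhr y := by
    have := integral_re hi
    simp only [RCLike.re_eq_complex_re] at this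
    rw [← this, hhr]
    refine integral_congr_ae (Eventually.of_forall fun w => ?_)
    simp only [Complex.re_ofReal_mul, Complex.add_re, Complex.ofReal_re, Complex.I_re,
      mul_zero, add_zero]
    ring
  rw [Complex.re_ofReal_mul, Complex.sub_re, Complex.sub_re, h3, show -(Complex.I * y) = ((-y : ℝ) : ℂ) * Complex.I by push_cast; ring, Complex.exp_mul_I,
      ← Complex.ofReal_cos, ← Complex.ofReal_sin, Real.cos_neg, Real.sin_neg] at h2
  simp only [Complex.sub_re, Complex.mul_re, Complex.add_re, Complex.add_im, Complex.mul_im, Complex.ofReal_re,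
    Complex.ofReal_im, Complex.I_re, Complex.I_im] at h2
  have e : √2 / π * (π / (2 * √2)) = 1 / 2 := by field_simp
  linear_combination h2 + (Real.cos y + Real.sin y) * e

lemma hh_contS : Continuous fresnelS := by
  unfold fresnelS
  refine continuous_const.mul ?_
  exact (intervalIntegral.continuous_primitive (fun a b => Continuous.intervalIntegrable (by fun_prop) a b) 0).comp
    Real.continuous_sqrt

lemma hh_contC : Continuous fresnelC := by
  unfold fresnelC
  refine continuous_const.mul ?_
  exact (intervalIntegral.continuous_primitive (fun a b => Continuous.intervalIntegrable (by fun_prop) a b) 0).comp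
    Real.continuous_sqrt

lemma hh_contk : Continuous hhk := by
  have := hh_contS
  have := hh_contC
  unfold hhk
  fun_prop

lemma hh_contK : Continuous hhK := by
  have := hh_contS
  have := hh_contC
  unfold hhK
  fun_prop

lemma hh_derivK (y : ℝ) (hy : 0 < y) : HasDerivAt hhK (hhk y) y := by
  have hs := Real.hasDerivAt_sqrt hy.ne'
  have gS : HasDerivAt (fun u : ℝ => ∫ t in (0:ℝ)..u, Real.sin (t ^ 2)) (Real.sin ((√y) ^ 2)) √y :=
    (Continuous.integral_hasStrictDerivAt (by fun_prop) 0 (√y)).hasDerivAt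
  have gC : HasDerivAt (fun u : ℝ => ∫ t in (0:ℝ)..u, Real.cos (t ^ 2)) (Real.cos ((√y) ^ 2)) √y :=
    (Continuous.integral_hasStrictDerivAt (by fun_prop) 0 (√y)).hasDerivAt
  have dS : HasDerivAt fresnelS _ y := (gS.comp y hs).const_mul (√(2 / π))
  have dC : HasDerivAt fresnelC _ y := (gC.comp y hs).const_mul (√(2 / π))
  have := ((Real.hasDerivAt_sin y).mul dC).sub ((Real.hasDerivAt_cos y).mul dS)
  refine HasDerivAt.congr_deriv this ?_
  rw [Real.sq_sqrt hy.le, hhk]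
  ring

noncomputable def hhE (g : ℝ → ℂ) (t : ℝ) : ℂ := ∫ s : ℝ, Complex.exp ((t * s : ℝ) * Complex.I) * g s

noncomputable def hhH (f : ℝ → ℂ) (t : ℝ) : ℂ :=
  ∫ s in Ioi (0 : ℝ), ((Real.cos (t * s) + Real.sin (t * s) : ℝ) : ℂ) * f s

lemma hhE_fourier (g : ℝ → ℂ) (t : ℝ) : hhE g t = FourierTransform.fourier g (-(2 * π)⁻¹ * t) := by
  rw [Real.fourier_eq', hhE]
  refine integral_congr_ae (Eventually.of_forall fun s => ?_)
  simp only [smul_eq_mul]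
  congr 4
  simp
  field_simp

lemma hh_expnorm (a : ℝ) : ‖Complex.exp ((a : ℂ) * Complex.I)‖ = 1 := Complex.norm_exp_ofReal_mul_I a

lemma hhE_int (g : ℝ → ℂ) (hg : Integrable g) (t : ℝ) :
    Integrable (fun s : ℝ => Complex.exp ((t * s : ℝ) * Complex.I) * g s) := by
  refine hg.bdd_mul (c := 1) (Continuous.aestronglyMeasurable (by fun_prop)) ?_
  exact Eventually.of_forall fun s => (hh_expnorm _).le

lemma hhE_le (g : ℝ → ℂ) (t : ℝ) : ‖hhE g t‖ ≤ ∫ s, ‖g s‖ := by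
  refine (norm_integral_le_integral_norm _).trans (le_of_eq ?_)
  refine integral_congr_ae (Eventually.of_forall fun s => ?_)
  simp only [norm_mul, hh_expnorm, one_mul]

lemma hhE_decay (g : ℝ → ℂ) (hg : ContDiff ℝ 2 g) (hs : HasCompactSupport g) :
    ∃ C : ℝ, 0 ≤ C ∧ ∀ t, ‖hhE g t‖ ≤ C * (1 + t ^ 2)⁻¹ := by
  have hg1 : ContDiff ℝ 1 (deriv g) := hg.iterate_deriv' 1 1
  have hg2 : ContDiff ℝ 0 (deriv (deriv g)) := hg.iterate_deriv' 0 2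
  have i0 : Integrable g := hg.continuous.integrable_of_hasCompactSupport hs
  have i1 : Integrable (deriv g) := hg1.continuous.integrable_of_hasCompactSupport hs.deriv
  have i2 : Integrable (deriv (deriv g)) := hg2.continuous.integrable_of_hasCompactSupport hs.deriv.deriv
  have e1 := Real.fourier_deriv i0 (hg.differentiable (by norm_num)) i1
  have e2 := Real.fourier_deriv i1 (hg1.differentiable (by norm_num)) i2
  have hE : ∀ t, hhE (deriv (deriv g)) t = - (t:ℂ) ^ 2 * hhE g t := by
    intro t
    rw [hhE_fourier, hhE_fourier, e2]
    simp only []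
    rw [e1]
    simp only [smul_eq_mul]
    have : (π : ℂ) ≠ 0 := by exact_mod_cast Real.pi_ne_zero
    push_cast
    field_simp
    rw [Complex.I_sq]
    ring
  refine ⟨(∫ s, ‖g s‖) + ∫ s, ‖deriv (deriv g) s‖, by positivity, fun t => ?_⟩
  have h0 := hhE_le g t
  have h2 := hhE_le (deriv (deriv g)) t
  rw [hE, norm_mul, norm_neg, norm_pow, Complex.norm_real, Real.norm_eq_abs, sq_abs] at h2
  rw [← div_eq_mul_inv, le_div_iff₀ (by positivity)]
  linarith

lemma hhE_deriv (g : ℝ → ℂ) (hg : Continuous g) (hs : HasCompactSupport g) (t : ℝ) :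
    HasDerivAt (hhE g) (hhE (fun s => Complex.I * s * g s) t) t := by
  have i0 : Integrable g := hg.integrable_of_hasCompactSupport hs
  have hc : Continuous (fun s : ℝ => Complex.I * s * g s) := by fun_prop
  have i1 : Integrable (fun s : ℝ => Complex.I * s * g s) := hc.integrable_of_hasCompactSupport hs.mul_left
  have := (hasDerivAt_integral_of_dominated_loc_of_deriv_le (μ := volume) (x₀ := t) (s := univ)
    (F := fun t s => Complex.exp ((t * s : ℝ) * Complex.I) * g s)
    (F' := fun t s => Complex.exp ((t * s : ℝ) * Complex.I) * (Complex.I * s * g s))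
    (bound := fun s => ‖Complex.I * s * g s‖) univ_mem ?_ (hhE_int g i0 t) ?_ ?_ i1.norm ?_).2
  · exact this
  · exact Eventually.of_forall fun t => (hhE_int g i0 t).aestronglyMeasurable
  · exact (hhE_int _ i1 t).aestronglyMeasurable
  · refine Eventually.of_forall fun s t _ => ?_
    rw [norm_mul, hh_expnorm, one_mul]
  · refine Eventually.of_forall fun s t _ => ?_
    have e : HasDerivAt (fun z : ℂ => Complex.exp ((z * s) * Complex.I) * g s)
        (Complex.exp (((t:ℂ) * s) * Complex.I) * (Complex.I * s * g s)) (t:ℂ) := by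
      have := ((((hasDerivAt_id (t:ℂ)).mul_const (s:ℂ)).mul_const Complex.I).cexp).mul_const (g s)
      refine HasDerivAt.congr_deriv this ?_
      simp
      ring
    have := e.comp_ofReal
    push_cast
    exact this

lemma hhE_cont (g : ℝ → ℂ) (hg : Continuous g) (hs : HasCompactSupport g) : Continuous (hhE g) :=
  continuous_iff_continuousAt.2 fun t => (hhE_deriv g hg hs t).continuousAt

lemma hhE_integrable (g : ℝ → ℂ) (hg : ContDiff ℝ 2 g) (hs : HasCompactSupport g) :
    Integrable (hhE g) := by
  obtain ⟨C, _, hC⟩ := hhE_decay g hg hs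
  exact (integrable_inv_one_add_sq.const_mul C).mono' (hhE_cont g hg.continuous hs).aestronglyMeasurable
    (Eventually.of_forall hC)

noncomputable def hhU (f : ℝ → ℂ) (x t : ℝ) : ℂ :=
  (Complex.exp (((-(x * t) : ℝ) : ℂ) * Complex.I) * hhE f t +
    Complex.exp (((x * t : ℝ) : ℂ) * Complex.I) * hhE f (-t)) / 2

noncomputable def hhV (f : ℝ → ℂ) (x t : ℝ) : ℂ :=
  (Complex.exp (((x * t : ℝ) : ℂ) * Complex.I) * hhE f t -
    Complex.exp (((-(x * t) : ℝ) : ℂ) * Complex.I) * hhE f (-t)) / (2 * Complex.I)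

lemma hh_inversion (f : ℝ → ℂ) (hf : ContDiff ℝ 2 f) (hs : HasCompactSupport f) (x : ℝ) :
    ∫ t in Ioi (0:ℝ), hhU f x t = π * f x := by
  have hEi := hhE_integrable f hf hs
  have h2 : (-(2 * π)⁻¹) ≠ 0 := by
    have := Real.pi_pos
    exact neg_ne_zero.2 (by positivity)
  have hFi : Integrable (FourierTransform.fourier f) := by
    rw [← integrable_comp_mul_left_iff _ h2]
    refine hEi.congr (Eventually.of_forall fun t => ?_)
    exact hhE_fourier f t
  have inv := congrFun (hf.continuous.fourierInv_fourier_eq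
    (hf.continuous.integrable_of_hasCompactSupport hs) hFi) x
  rw [Real.fourierInv_eq'] at inv
  have sub := Measure.integral_comp_mul_left (fun v : ℝ =>
    Complex.exp (((2 * π * inner ℝ v x : ℝ) : ℂ) * Complex.I) • FourierTransform.fourier f v) (-(2 * π)⁻¹)
  rw [inv] at sub
  have e : ∀ t : ℝ, Complex.exp (((2 * π * inner ℝ (-(2 * π)⁻¹ * t) x : ℝ) : ℂ) * Complex.I) •
      FourierTransform.fourier f (-(2 * π)⁻¹ * t) = Complex.exp (((-(x * t) : ℝ) : ℂ) * Complex.I) * hhE f t := by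
    intro t
    rw [← hhE_fourier, smul_eq_mul]
    congr 4
    simp
    field_simp
  simp_rw [e] at sub
  have hi : Integrable (fun t : ℝ => Complex.exp (((-(x * t) : ℝ) : ℂ) * Complex.I) * hhE f t) := by
    refine hEi.bdd_mul (c := 1) (Continuous.aestronglyMeasurable (by fun_prop)) ?_
    exact Eventually.of_forall fun s => (hh_expnorm _).le
  rw [← intervalIntegral.integral_Iic_add_Ioi (b := 0) hi.integrableOn hi.integrableOn] at sub
  have hn := integral_comp_neg_Ioi 0 (fun t : ℝ => Complex.exp (((-(x * t) : ℝ) : ℂ) * Complex.I) * hhE f t)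
  rw [neg_zero] at hn
  rw [← hn, ← integral_add hi.comp_neg.integrableOn hi.integrableOn] at sub
  have e3 : |(-(2 * π)⁻¹)⁻¹| = 2 * π := by
    rw [inv_neg, inv_inv, abs_neg, abs_of_pos (by positivity)]
  rw [e3] at sub
  have : ∀ t : ℝ, hhU f x t = (1/2 : ℂ) * (Complex.exp (((-(x * -t) : ℝ) : ℂ) * Complex.I) * hhE f (-t)
    + Complex.exp (((-(x * t) : ℝ) : ℂ) * Complex.I) * hhE f t) := by
    intro t
    rw [hhU, mul_neg, neg_neg]
    ring
  simp_rw [this]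
  rw [integral_const_mul, sub, Complex.real_smul]
  push_cast
  ring

lemma hh_supp (f : ℝ → ℂ) (hpos : tsupport f ⊆ Ioi (0 : ℝ)) (g : ℝ → ℂ) :
    ∫ s in Ioi (0:ℝ), g s * f s = ∫ s, g s * f s := by
  refine setIntegral_eq_integral_of_forall_compl_eq_zero fun s hs => ?_
  rw [image_eq_zero_of_notMem_tsupport (fun h => hs (hpos h)), mul_zero]

lemma hhH_eq (f : ℝ → ℂ) (hf : Integrable f) (hpos : tsupport f ⊆ Ioi (0 : ℝ)) (t : ℝ) :
    hhH f t = ((1 - Complex.I) * hhE f t + (1 + Complex.I) * hhE f (-t)) / 2 := by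
  rw [hhH, hh_supp f hpos (fun s => ((Real.cos (t * s) + Real.sin (t * s) : ℝ) : ℂ)), hhE, hhE,
    ← integral_const_mul, ← integral_const_mul, ← integral_add ((hhE_int f hf t).const_mul _)
      ((hhE_int f hf (-t)).const_mul _), ← integral_div]
  refine integral_congr_ae (Eventually.of_forall fun s => ?_)
  simp only []
  rw [Complex.exp_mul_I, Complex.exp_mul_I, neg_mul]
  push_cast
  rw [Complex.cos_neg, Complex.sin_neg]
  linear_combination (Complex.sin (t * s) * f s) * Complex.I_sq

lemma hhV_eq (f : ℝ → ℂ) (hf : Integrable f) (hpos : tsupport f ⊆ Ioi (0 : ℝ)) (x t : ℝ) :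
    hhV f x t = ∫ s in Ioi (0:ℝ), ((Real.sin (t * (x + s)) : ℝ) : ℂ) * f s := by
  rw [hhV, hh_supp f hpos (fun s => ((Real.sin (t * (x + s)) : ℝ) : ℂ)), hhE, hhE,
    ← integral_const_mul, ← integral_const_mul, ← integral_sub ((hhE_int f hf t).const_mul _)
      ((hhE_int f hf (-t)).const_mul _), ← integral_div]
  refine integral_congr_ae (Eventually.of_forall fun s => ?_)
  simp only []
  rw [← mul_assoc, ← mul_assoc, ← Complex.exp_add, ← Complex.exp_add, ← add_mul, ← add_mul,
    ← Complex.ofReal_add, ← Complex.ofReal_add, show x * t + t * s = t * (x + s) by ring,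
    show -(x * t) + -t * s = - (t * (x + s)) by ring, Complex.exp_mul_I, Complex.exp_mul_I]
  push_cast
  rw [Complex.cos_neg, Complex.sin_neg]
  have := Complex.I_ne_zero
  field_simp
  ring

lemma hhUV (f : ℝ → ℂ) (hf : Integrable f) (hpos : tsupport f ⊆ Ioi (0 : ℝ)) (x t : ℝ) :
    ((Real.cos (x * t) + Real.sin (x * t) : ℝ) : ℂ) * hhH f t = hhU f x t + hhV f x t := by
  rw [hhH_eq f hf hpos, hhU, hhV, Complex.exp_mul_I, Complex.exp_mul_I]
  push_cast
  rw [Complex.cos_neg, Complex.sin_neg]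
  have h := Complex.I_ne_zero
  have h2 := Complex.I_sq
  have h3 : (2 * Complex.I)⁻¹ = - Complex.I / 2 := by simp; ring
  rw [div_eq_mul_inv _ (2 * Complex.I), h3]
  generalize Complex.cos _ = c
  generalize Complex.sin _ = d
  linear_combination (d * (hhE f t) / 2 + d * hhE f (-t) / 2) * h2

lemma hhH_deriv (f : ℝ → ℂ) (hf : ContDiff ℝ 2 f) (hs : HasCompactSupport f)
    (hpos : tsupport f ⊆ Ioi (0 : ℝ)) :
    ∃ (H' : ℝ → ℂ) (C : ℝ), 0 ≤ C ∧ Continuous H' ∧ (∀ t, HasDerivAt (hhH f) (H' t) t) ∧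
      (∀ t, ‖hhH f t‖ ≤ C * (1 + t ^ 2)⁻¹) ∧ (∀ t, ‖H' t‖ ≤ C * (1 + t ^ 2)⁻¹) := by
  have hi := hf.continuous.integrable_of_hasCompactSupport hs (μ := volume)
  set g : ℝ → ℂ := fun s => Complex.I * s * f s with hg
  have hgc : ContDiff ℝ 2 g := by
    refine ContDiff.mul (contDiff_const.mul Complex.ofRealCLM.contDiff) hf
  have hgs : HasCompactSupport g := hs.mul_left
  obtain ⟨C1, hC1, h1⟩ := hhE_decay f hf hs
  obtain ⟨C2, hC2, h2⟩ := hhE_decay g hgc hgs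
  have gE := hhE_cont g hgc.continuous hgs
  have bd : ∀ (a b : ℂ) (c : ℝ), ‖a‖ ≤ c → ‖b‖ ≤ c → 
      ‖((1 - Complex.I) * a + (1 + Complex.I) * b) / 2‖ ≤ 2 * c := by
    intro a b c ha hb
    have n1 : ‖1 - Complex.I‖ ≤ 2 := (norm_sub_le _ _).trans (by simp; norm_num)
    have n2 : ‖1 + Complex.I‖ ≤ 2 := (norm_add_le _ _).trans (by simp; norm_num)
    rw [norm_div, Complex.norm_ofNat, div_le_iff₀ (by norm_num)]
    refine (norm_add_le _ _).trans ?_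
    rw [norm_mul, norm_mul]
    have := mul_le_mul n1 ha (norm_nonneg _) (by norm_num)
    have := mul_le_mul n2 hb (norm_nonneg _) (by norm_num)
    linarith
  refine ⟨fun t => ((1 - Complex.I) * hhE g t + (1 + Complex.I) * (-hhE g (-t))) / 2, 2 * (C1 + C2),
    by positivity, by fun_prop, ?_, ?_, ?_⟩
  · intro t
    rw [show hhH f = fun t => ((1 - Complex.I) * hhE f t + (1 + Complex.I) * hhE f (-t)) / 2 from
      funext (hhH_eq f hi hpos)]
    have d1 := hhE_deriv f hf.continuous hs t
    have d2 := (hhE_deriv f hf.continuous hs (-t)).scomp t (hasDerivAt_neg t)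
    have := ((d1.const_mul (1 - Complex.I)).add (d2.const_mul (1 + Complex.I))).div_const 2
    refine HasDerivAt.congr_deriv this ?_
    simp [hg]
  · intro t
    rw [hhH_eq f hi hpos, mul_assoc]
    have p : 0 ≤ (1 + t ^ 2)⁻¹ := by positivity
    have a := h1 t
    have b := h1 (-t)
    rw [neg_sq] at b
    apply bd <;> nlinarith
  · intro t
    rw [mul_assoc]
    have p : 0 ≤ (1 + t ^ 2)⁻¹ := by positivity
    have a := h2 t
    have b := h2 (-t)
    rw [neg_sq, ← norm_neg] at b
    apply bd <;> nlinarith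

lemma hh_laplace (p a : ℝ) (hp : 0 < p) :
    (∫ t in Ioi (0:ℝ), Real.exp (-(p * t)) * Real.cos (t * a) = p / (p ^ 2 + a ^ 2)) ∧
    (∫ t in Ioi (0:ℝ), Real.exp (-(p * t)) * Real.sin (t * a) = a / (p ^ 2 + a ^ 2)) ∧
    IntegrableOn (fun t : ℝ => Real.exp (-(p * t)) * Real.cos (t * a)) (Ioi 0) ∧
    IntegrableOn (fun t : ℝ => Real.exp (-(p * t)) * Real.sin (t * a)) (Ioi 0) := by
  have hre : (-(p:ℂ) + a * Complex.I).re < 0 := by simpa using hp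
  have h := integral_exp_mul_complex_Ioi hre 0
  have hi := integrableOn_exp_mul_complex_Ioi hre 0
  have hne : (-(p:ℂ) + a * Complex.I) ≠ 0 := by
    intro h0
    rw [h0] at hre
    simp at hre
  have hne2 : ((p:ℂ) ^ 2 + (a:ℂ) ^ 2) ≠ 0 := by
    have : p ^ 2 + a ^ 2 ≠ 0 := by positivity
    exact_mod_cast this
  have hv : -Complex.exp ((-(p:ℂ) + a * Complex.I) * (0:ℝ)) / (-(p:ℂ) + a * Complex.I) =
      ((p / (p ^ 2 + a ^ 2) : ℝ) : ℂ) + ((a / (p ^ 2 + a ^ 2) : ℝ) : ℂ) * Complex.I := by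
    rw [div_eq_iff hne]
    push_cast
    simp only [mul_zero, Complex.exp_zero]
    field_simp
    linear_combination (-(a:ℂ) ^ 2) * Complex.I_sq
  have e : ∀ t : ℝ, Complex.exp ((-(p:ℂ) + a * Complex.I) * t) =
      ((Real.exp (-(p * t)) * Real.cos (t * a) : ℝ) : ℂ) +
        ((Real.exp (-(p * t)) * Real.sin (t * a) : ℝ) : ℂ) * Complex.I := by
    intro t
    rw [show (-(p:ℂ) + a * Complex.I) * t = ((-(p * t) : ℝ) : ℂ) + ((t * a : ℝ) : ℂ) * Complex.I by
      push_cast; ring, Complex.exp_add, Complex.exp_mul_I]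
    push_cast
    ring
  rw [hv] at h
  simp_rw [e] at h hi
  have r1 := integral_re hi
  have r2 := integral_im hi
  rw [h] at r1 r2
  have q1 := hi.re
  have q2 := hi.im
  simp only [RCLike.re_eq_complex_re, RCLike.im_eq_complex_im, Complex.add_re, Complex.add_im,
    Complex.ofReal_re, Complex.ofReal_im, Complex.re_ofReal_mul, Complex.im_ofReal_mul, Complex.I_re,
    Complex.I_im, mul_zero, mul_one, add_zero, zero_add] at r1 r2 q1 q2
  exact ⟨r1, r2, q1, q2⟩

lemma hh_expint (p : ℝ) (hp : 0 < p) : IntegrableOn (fun t : ℝ => Real.exp (-(p * t))) (Ioi 0) := by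
  simpa using (hh_laplace p 0 hp).2.2.1

lemma hh_expval (p : ℝ) (hp : 0 < p) : ∫ t in Ioi (0:ℝ), Real.exp (-(p * t)) = 1 / p := by
  have := (hh_laplace p 0 hp).1
  simp only [mul_zero, Real.cos_zero, mul_one] at this
  rw [this]
  field_simp
  simp

lemma hhU_int (f : ℝ → ℂ) (hE : Integrable (hhE f)) (x : ℝ) : Integrable (hhU f x) := by
  have a : Integrable (fun t : ℝ => Complex.exp (((-(x * t) : ℝ) : ℂ) * Complex.I) * hhE f t) := by
    refine hE.bdd_mul (c := 1) (Continuous.aestronglyMeasurable (by fun_prop)) ?_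
    exact Eventually.of_forall fun s => (hh_expnorm _).le
  have b : Integrable (fun t : ℝ => Complex.exp (((x * t : ℝ) : ℂ) * Complex.I) * hhE f (-t)) := by
    refine hE.comp_neg.bdd_mul (c := 1) (Continuous.aestronglyMeasurable (by fun_prop)) ?_
    exact Eventually.of_forall fun s => (hh_expnorm _).le
  exact (a.add b).div_const 2

lemma hhV_int (f : ℝ → ℂ) (hE : Integrable (hhE f)) (x : ℝ) : Integrable (hhV f x) := by
  have a : Integrable (fun t : ℝ => Complex.exp (((x * t : ℝ) : ℂ) * Complex.I) * hhE f t) := by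
    refine hE.bdd_mul (c := 1) (Continuous.aestronglyMeasurable (by fun_prop)) ?_
    exact Eventually.of_forall fun s => (hh_expnorm _).le
  have b : Integrable (fun t : ℝ => Complex.exp (((-(x * t) : ℝ) : ℂ) * Complex.I) * hhE f (-t)) := by
    refine hE.comp_neg.bdd_mul (c := 1) (Continuous.aestronglyMeasurable (by fun_prop)) ?_
    exact Eventually.of_forall fun s => (hh_expnorm _).le
  exact (a.sub b).div_const _

lemma hh_abel_eps (f : ℝ → ℂ) (hf : Integrable f) (hpos : tsupport f ⊆ Ioi (0 : ℝ)) (x ε : ℝ)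
    (hε : 0 < ε) :
    ∫ t in Ioi (0:ℝ), ((Real.exp (-(ε * t)) : ℝ) : ℂ) * hhV f x t =
      ∫ s in Ioi (0:ℝ), (((x + s) / (ε ^ 2 + (x + s) ^ 2) : ℝ) : ℂ) * f s := by
  have hI : Integrable (Function.uncurry fun t s : ℝ =>
      ((Real.sin (t * (x + s)) : ℝ) : ℂ) * (((Real.exp (-(ε * t)) : ℝ) : ℂ) * f s))
      ((volume.restrict (Ioi (0:ℝ))).prod (volume.restrict (Ioi (0:ℝ)))) := by
    have : Integrable (fun z : ℝ × ℝ => ((Real.exp (-(ε * z.1)) : ℝ) : ℂ) * f z.2)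
      ((volume.restrict (Ioi (0:ℝ))).prod (volume.restrict (Ioi (0:ℝ)))) :=
      Integrable.mul_prod (f := fun t : ℝ => ((Real.exp (-(ε * t)) : ℝ) : ℂ)) (hh_expint ε hε).ofReal
        hf.integrableOn
    refine this.bdd_mul (c := 1) (f := fun z : ℝ × ℝ => ((Real.sin (z.1 * (z.2 + x)) : ℝ) : ℂ)) ?_ ?_ |>.congr ?_
    · exact Continuous.aestronglyMeasurable (by fun_prop)
    · refine Eventually.of_forall fun z => ?_
      rw [Complex.norm_real]
      exact Real.abs_sin_le_one _
    · refine Eventually.of_forall fun z => ?_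
      simp only [Function.uncurry, add_comm x]
  have sw := integral_integral_swap hI
  have e1 : ∀ t : ℝ, ((Real.exp (-(ε * t)) : ℝ) : ℂ) * hhV f x t = ∫ s in Ioi (0:ℝ),
      ((Real.sin (t * (x + s)) : ℝ) : ℂ) * (((Real.exp (-(ε * t)) : ℝ) : ℂ) * f s) := by
    intro t
    rw [hhV_eq f hf hpos, ← integral_const_mul]
    refine integral_congr_ae (Eventually.of_forall fun s => ?_)
    simp only []
    ring
  simp_rw [e1]
  rw [sw]
  refine integral_congr_ae (Eventually.of_forall fun s => ?_)
  simp only []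
  rw [← (hh_laplace ε (x + s) hε).2.1, ← integral_complex_ofReal, ← integral_mul_const]
  refine integral_congr_ae (Eventually.of_forall fun t => ?_)
  simp only []
  push_cast
  ring

lemma hh_abel (f : ℝ → ℂ) (hf : Integrable f) (hE : Integrable (hhE f))
    (hpos : tsupport f ⊆ Ioi (0 : ℝ)) (x : ℝ) (hx : 0 < x) :
    ∫ t in Ioi (0:ℝ), hhV f x t = ∫ s in Ioi (0:ℝ), ((1 / (x + s) : ℝ) : ℂ) * f s := by
  have l1 : Tendsto (fun ε : ℝ => ∫ t in Ioi (0:ℝ), ((Real.exp (-(ε * t)) : ℝ) : ℂ) * hhV f x t)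
      (𝓝[>] 0) (𝓝 (∫ t in Ioi (0:ℝ), hhV f x t)) := by
    refine tendsto_integral_filter_of_dominated_convergence (fun t => ‖hhV f x t‖) ?_ ?_
      (hhV_int f hE x).norm.integrableOn ?_
    · refine Eventually.of_forall fun ε => ?_
      exact (Continuous.aestronglyMeasurable (by fun_prop)).mul (hhV_int f hE x).aestronglyMeasurable.restrict
    · filter_upwards [self_mem_nhdsWithin] with ε hε
      filter_upwards [ae_restrict_mem measurableSet_Ioi] with t ht
      rw [norm_mul, Complex.norm_real, Real.norm_of_nonneg (Real.exp_pos _).le]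
      refine mul_le_of_le_one_left (norm_nonneg _) ?_
      rw [Real.exp_le_one_iff]
      have := mul_pos (mem_Ioi.1 hε) (mem_Ioi.1 ht)
      linarith
    · refine Eventually.of_forall fun t => ?_
      have : Continuous (fun ε : ℝ => ((Real.exp (-(ε * t)) : ℝ) : ℂ) * hhV f x t) := by fun_prop
      have := this.tendsto 0
      simp only [zero_mul, neg_zero, Real.exp_zero, Complex.ofReal_one, one_mul] at this
      exact this.mono_left nhdsWithin_le_nhds
  have l2 : Tendsto (fun ε : ℝ => ∫ s in Ioi (0:ℝ), (((x + s) / (ε ^ 2 + (x + s) ^ 2) : ℝ) : ℂ) * f s)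
      (𝓝[>] 0) (𝓝 (∫ s in Ioi (0:ℝ), ((1 / (x + s) : ℝ) : ℂ) * f s)) := by
    refine tendsto_integral_filter_of_dominated_convergence (fun s => 1 / x * ‖f s‖) ?_ ?_
      (hf.norm.const_mul _).integrableOn ?_
    · refine Eventually.of_forall fun ε => ?_
      refine AEStronglyMeasurable.mul (Measurable.aestronglyMeasurable (by fun_prop)) hf.aestronglyMeasurable.restrict
    · filter_upwards [self_mem_nhdsWithin] with ε hε
      filter_upwards [ae_restrict_mem measurableSet_Ioi] with s hs
      have hs : 0 < s := hs
      rw [norm_mul, Complex.norm_real, Real.norm_of_nonneg (by positivity)]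
      refine mul_le_mul_of_nonneg_right ?_ (norm_nonneg _)
      rw [div_le_div_iff₀ (by positivity) hx]
      nlinarith [sq_nonneg ε]
    · filter_upwards [ae_restrict_mem measurableSet_Ioi] with s hs
      have hs : 0 < s := hs
      have : ContinuousAt (fun ε : ℝ => (((x + s) / (ε ^ 2 + (x + s) ^ 2) : ℝ) : ℂ) * f s) 0 := by
        refine ContinuousAt.mul ?_ continuousAt_const
        refine Complex.continuous_ofReal.continuousAt.comp ?_
        refine ContinuousAt.div continuousAt_const (by fun_prop) (by positivity)
      have := this.tendsto
      rw [show (x + s) / ((0:ℝ) ^ 2 + (x + s) ^ 2) = 1 / (x + s) by field_simp; ring] at this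
      exact this.mono_left nhdsWithin_le_nhds
  refine tendsto_nhds_unique l1 (l2.congr' ?_)
  filter_upwards [self_mem_nhdsWithin] with ε hε
  exact (hh_abel_eps f hf hpos x ε hε).symm

lemma hhr_prod (x : ℝ) (hx : 0 < x) : Integrable (Function.uncurry fun w t : ℝ =>
    w ^ 2 / (1 + w ^ 4) * Real.exp (-(w ^ 2 * (x * t))))
    ((volume.restrict (Ioi (0:ℝ))).prod (volume.restrict (Ioi (0:ℝ)))) := by
  rw [integrable_prod_iff]
  · constructor
    · filter_upwards [ae_restrict_mem measurableSet_Ioi] with w hw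
      have hw : 0 < w := hw
      simp only [Function.uncurry, ← mul_assoc]
      exact (hh_expint (w ^ 2 * x) (by positivity)).const_mul _
    · have : IntegrableOn (fun w : ℝ => 1 / x * (1 / (1 + w ^ 4))) (Ioi 0) :=
        (hh_int0.const_mul _).integrableOn
      refine this.congr_fun (fun w hw => ?_) measurableSet_Ioi
      have hw : 0 < w := hw
      simp only [Function.uncurry]
      have e : ∀ t : ℝ, ‖w ^ 2 / (1 + w ^ 4) * Real.exp (-(w ^ 2 * (x * t)))‖ =
          w ^ 2 / (1 + w ^ 4) * Real.exp (-(w ^ 2 * x * t)) := by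
        intro t
        rw [Real.norm_of_nonneg (by positivity), mul_assoc (w ^ 2)]
      simp_rw [e]
      rw [integral_const_mul, hh_expval _ (by positivity)]
      field_simp
  · refine Measurable.aestronglyMeasurable ?_
    simp only [Function.uncurry_def]
    fun_prop

lemma hhr_int (x : ℝ) (hx : 0 < x) : IntegrableOn (fun t => hhr (x * t)) (Ioi 0) :=
  (hhr_prod x hx).integral_prod_right

lemma hhr_trig (x s : ℝ) (hx : 0 < x) (hs : 0 < s) (hne : s ≠ x) :
    ∫ t in Ioi (0:ℝ), hhr (x * t) * (Real.cos (t * s) + Real.sin (t * s)) = π / (2 * √2) / (x + s) := by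
  have hI : Integrable (Function.uncurry fun w t : ℝ =>
      (Real.cos (t * s) + Real.sin (t * s)) * (w ^ 2 / (1 + w ^ 4) * Real.exp (-(w ^ 2 * (x * t)))))
      ((volume.restrict (Ioi (0:ℝ))).prod (volume.restrict (Ioi (0:ℝ)))) := by
    refine (hhr_prod x hx).bdd_mul (c := 2) (f := fun z : ℝ × ℝ => Real.cos (z.2 * s) + Real.sin (z.2 * s)) ?_ ?_
    · exact Continuous.aestronglyMeasurable (by fun_prop)
    · refine Eventually.of_forall fun z => (norm_add_le _ _).trans ?_
      have := Real.abs_cos_le_one (z.2 * s)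
      have := Real.abs_sin_le_one (z.2 * s)
      simp only [Real.norm_eq_abs]
      linarith
  have sw := integral_integral_swap hI
  rw [← hh_key x s hx hs hne]
  have e1 : ∀ t : ℝ, hhr (x * t) * (Real.cos (t * s) + Real.sin (t * s)) = ∫ w in Ioi (0:ℝ),
      (Real.cos (t * s) + Real.sin (t * s)) * (w ^ 2 / (1 + w ^ 4) * Real.exp (-(w ^ 2 * (x * t)))) := by
    intro t
    rw [integral_const_mul, hhr, mul_comm]
  simp_rw [e1]
  rw [← sw]
  refine setIntegral_congr_fun measurableSet_Ioi fun w hw => ?_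
  have hw : 0 < w := hw
  obtain ⟨l1, l2, i1, i2⟩ := hh_laplace (w ^ 2 * x) s (by positivity)
  have e2 : ∀ t : ℝ, (Real.cos (t * s) + Real.sin (t * s)) * (w ^ 2 / (1 + w ^ 4) * Real.exp (-(w ^ 2 * (x * t))))
      = w ^ 2 / (1 + w ^ 4) * (Real.exp (-(w ^ 2 * x * t)) * Real.cos (t * s) +
        Real.exp (-(w ^ 2 * x * t)) * Real.sin (t * s)) := by
    intro t
    rw [mul_assoc (w ^ 2) x t]
    ring
  simp_rw [e2]
  rw [integral_const_mul, integral_add i1 i2, l1, l2]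
  ring

lemma hhr_H (f : ℝ → ℂ) (hf : Integrable f) (x : ℝ) (hx : 0 < x) :
    ∫ t in Ioi (0:ℝ), ((hhr (x * t) : ℝ) : ℂ) * hhH f t =
      ((π / (2 * √2) : ℝ) : ℂ) * ∫ s in Ioi (0:ℝ), ((1 / (x + s) : ℝ) : ℂ) * f s := by
  have hI : Integrable (Function.uncurry fun t s : ℝ =>
      ((Real.cos (t * s) + Real.sin (t * s) : ℝ) : ℂ) * (((hhr (x * t) : ℝ) : ℂ) * f s))
      ((volume.restrict (Ioi (0:ℝ))).prod (volume.restrict (Ioi (0:ℝ)))) := by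
    have : Integrable (fun z : ℝ × ℝ => ((hhr (x * z.1) : ℝ) : ℂ) * f z.2)
      ((volume.restrict (Ioi (0:ℝ))).prod (volume.restrict (Ioi (0:ℝ)))) :=
      Integrable.mul_prod (f := fun t : ℝ => ((hhr (x * t) : ℝ) : ℂ)) (hhr_int x hx).ofReal
        hf.integrableOn
    refine this.bdd_mul (c := 2) (f := fun z : ℝ × ℝ => ((Real.cos (z.1 * z.2) + Real.sin (z.1 * z.2) : ℝ) : ℂ)) ?_ ?_
    · exact Continuous.aestronglyMeasurable (by fun_prop)
    · refine Eventually.of_forall fun z => ?_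
      rw [Complex.norm_real]
      refine (norm_add_le _ _).trans ?_
      have := Real.abs_cos_le_one (z.1 * z.2)
      have := Real.abs_sin_le_one (z.1 * z.2)
      simp only [Real.norm_eq_abs]
      linarith
  have sw := integral_integral_swap hI
  have e1 : ∀ t : ℝ, ((hhr (x * t) : ℝ) : ℂ) * hhH f t = ∫ s in Ioi (0:ℝ),
      ((Real.cos (t * s) + Real.sin (t * s) : ℝ) : ℂ) * (((hhr (x * t) : ℝ) : ℂ) * f s) := by
    intro t
    rw [hhH, ← integral_const_mul]
    refine integral_congr_ae (Eventually.of_forall fun s => ?_)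
    simp only []
    ring
  simp_rw [e1]
  rw [sw, ← integral_const_mul]
  have hne : ∀ᵐ s ∂(volume.restrict (Ioi (0:ℝ))), s ≠ x :=
    ae_restrict_of_ae (Measure.ae_ne volume x)
  refine integral_congr_ae ?_
  filter_upwards [hne, ae_restrict_mem measurableSet_Ioi] with s h1 h2
  have := hhr_trig x s hx h2 h1
  rw [← mul_assoc, ← Complex.ofReal_mul, mul_one_div, ← this, ← integral_complex_ofReal, ← integral_mul_const]
  refine integral_congr_ae (Eventually.of_forall fun t => ?_)
  simp only []
  push_cast
  ring

lemma hh_pointwise_s6 (f : ℝ → ℂ) (hf : ContDiff ℝ 2 f) (hs : HasCompactSupport f)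
    (hpos : tsupport f ⊆ Ioi (0 : ℝ)) (x : ℝ) (hx : 0 < x) :
    ∫ t in Ioi (0:ℝ), ((hhk (x * t) : ℝ) : ℂ) * hhH f t = (π / 2 : ℂ) * f x := by
  have hi := hf.continuous.integrable_of_hasCompactSupport hs (μ := volume)
  have hE := hhE_integrable f hf hs
  obtain ⟨H', C, hC, -, hd, hb, -⟩ := hhH_deriv f hf hs hpos
  have hHc : Continuous (hhH f) := continuous_iff_continuousAt.2 fun t => (hd t).continuousAt
  have hrH : IntegrableOn (fun t : ℝ => ((hhr (x * t) : ℝ) : ℂ) * hhH f t) (Ioi 0) := by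
    refine (hhr_int x hx).ofReal.mul_bdd (c := C) hHc.aestronglyMeasurable ?_
    refine Eventually.of_forall fun t => (hb t).trans ?_
    refine mul_le_of_le_one_right hC ?_
    exact inv_le_one_of_one_le₀ (by nlinarith [sq_nonneg t])
  have e : ∀ t ∈ Ioi (0:ℝ), ((hhk (x * t) : ℝ) : ℂ) * hhH f t =
      (1 / 2 : ℂ) * (hhU f x t + hhV f x t) - ((√2 / π : ℝ) : ℂ) * (((hhr (x * t) : ℝ) : ℂ) * hhH f t) := by
    intro t ht
    rw [hh_k_eq _ (mul_pos hx ht).le, ← hhUV f hi hpos]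
    push_cast
    ring
  rw [setIntegral_congr_fun measurableSet_Ioi e, integral_sub, integral_const_mul, integral_const_mul,
    integral_add (hhU_int f hE x).integrableOn (hhV_int f hE x).integrableOn, hh_inversion f hf hs,
    hh_abel f hi hE hpos x hx, hhr_H f hi x hx, ← mul_assoc ((√2 / π : ℝ) : ℂ), ← Complex.ofReal_mul,
    show √2 / π * (π / (2 * √2)) = 1 / 2 by field_simp]
  · push_cast
    ring
  · exact (((hhU_int f hE x).add (hhV_int f hE x)).const_mul _).integrableOn
  · exact hrH.const_mul _

noncomputable def hhe (N : ℝ) : ℝ := (π / 2 - Real.arctan N) + (1 + N ^ 2)⁻¹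

lemma hhe_tendsto : Tendsto hhe atTop (𝓝 0) := by
  have t := tendsto_nhds_of_tendsto_nhdsWithin Real.tendsto_arctan_atTop
  have a := t.const_sub (π / 2)
  have b : Tendsto (fun N : ℝ => (1 + N ^ 2)⁻¹) atTop (𝓝 0) :=
    tendsto_inv_atTop_zero.comp (tendsto_atTop_add_const_left _ _ (tendsto_pow_atTop (by norm_num)))
  have := a.add b
  rw [sub_self, add_zero] at this
  exact this

lemma hh_tail (f : ℝ → ℂ) (hf : ContDiff ℝ 2 f) (hs : HasCompactSupport f)
    (hpos : tsupport f ⊆ Ioi (0 : ℝ)) :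
    ∃ D : ℝ, ∀ x N : ℝ, 0 < x → 0 ≤ N →
      IntegrableOn (fun t : ℝ => ((hhk (x * t) : ℝ) : ℂ) * hhH f t) (Ioi N) ∧
      ‖∫ t in Ioi N, ((hhk (x * t) : ℝ) : ℂ) * hhH f t‖ ≤ D * hhe N ∧
      ‖∫ t in Ioi N, ((hhk (x * t) : ℝ) : ℂ) * hhH f t‖ ≤ D * hhe N / x := by
  obtain ⟨H', C, hC, hH'c, hd, hb, hb'⟩ := hhH_deriv f hf hs hpos
  have hHc : Continuous (hhH f) := continuous_iff_continuousAt.2 fun t => (hd t).continuousAt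
  obtain ⟨B, hB, hkB⟩ := hh_bd
  have ck := hh_contk
  have cK := hh_contK
  refine ⟨C * B, fun x N hx hN => ?_⟩
  have hval : ∀ c : ℝ, ∫ t in Ioi N, c * (1 + t ^ 2)⁻¹ = c * (π / 2 - Real.arctan N) := by
    intro c
    rw [integral_const_mul, integral_Ioi_inv_one_add_sq]
  have n1 : ∀ t ∈ Ioi N, ‖((hhk (x * t) : ℝ) : ℂ) * hhH f t‖ ≤ C * B * (1 + t ^ 2)⁻¹ := by
    intro t ht
    rw [norm_mul, Complex.norm_real, Real.norm_eq_abs]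
    have a := (hkB (x * t) (mul_pos hx (hN.trans_lt ht)).le).1
    have := mul_le_mul a (hb t) (norm_nonneg _) hB.le
    linarith
  have n2 : ∀ t ∈ Ici N, ∀ z : ℂ, ‖z‖ ≤ C * (1 + t ^ 2)⁻¹ →
      ‖z * ((hhK (x * t) / x : ℝ) : ℂ)‖ ≤ C * B / x * (1 + t ^ 2)⁻¹ := by
    intro t ht z hz
    rw [norm_mul, Complex.norm_real, Real.norm_eq_abs, abs_div, abs_of_pos hx]
    have a := (hkB (x * t) (mul_nonneg hx.le (hN.trans ht))).2
    have a' : |hhK (x * t)| / x ≤ B / x := by gcongr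
    have := mul_le_mul hz a' (by positivity) (by positivity)
    refine this.trans (le_of_eq ?_)
    ring
  have Ig : ∀ c : ℝ, IntegrableOn (fun t : ℝ => c * (1 + t ^ 2)⁻¹) (Ioi N) := fun c =>
    (integrable_inv_one_add_sq.const_mul c).integrableOn
  have I1 : IntegrableOn (fun t : ℝ => ((hhk (x * t) : ℝ) : ℂ) * hhH f t) (Ioi N) := by
    refine (Ig (C * B)).mono' (Continuous.aestronglyMeasurable (by fun_prop)) ?_
    filter_upwards [ae_restrict_mem measurableSet_Ioi] with t ht using n1 t ht
  have I2 : IntegrableOn (fun t : ℝ => H' t * ((hhK (x * t) / x : ℝ) : ℂ)) (Ioi N) := by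
    refine (Ig (C * B / x)).mono' (Continuous.aestronglyMeasurable (by fun_prop)) ?_
    filter_upwards [ae_restrict_mem measurableSet_Ioi] with t ht using n2 t (Ioi_subset_Ici_self ht) _ (hb' t)
  refine ⟨I1, ?_, ?_⟩
  · refine (norm_integral_le_of_norm_le (Ig (C * B)) ?_).trans ?_
    · filter_upwards [ae_restrict_mem measurableSet_Ioi] with t ht using n1 t ht
    · rw [hval, hhe]
      have : 0 ≤ (1 + N ^ 2)⁻¹ := by positivity
      have : 0 ≤ C * B := by positivity
      gcongr
      linarith
  · have parts := integral_Ioi_mul_deriv_eq_deriv_mul (A := ℂ) (a := N) (u := hhH f) (u' := H')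
      (v := fun t : ℝ => ((hhK (x * t) / x : ℝ) : ℂ)) (v' := fun t : ℝ => ((hhk (x * t) : ℝ) : ℂ))
      (a' := hhH f N * ((hhK (x * N) / x : ℝ) : ℂ)) (b' := 0)
      (fun t _ => hd t) ?_ ?_ I2 ?_ ?_
    · simp_rw [mul_comm _ (hhH f _)]
      rw [parts, zero_sub]
      refine (norm_sub_le _ _).trans ?_
      rw [norm_neg]
      have a := n2 N (mem_Ici.2 le_rfl) _ (hb N)
      have b : ‖∫ t in Ioi N, H' t * ((hhK (x * t) / x : ℝ) : ℂ)‖ ≤ C * B / x * (π / 2 - Real.arctan N) := by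
        rw [← hval]
        refine norm_integral_le_of_norm_le (Ig (C * B / x)) ?_
        filter_upwards [ae_restrict_mem measurableSet_Ioi] with t ht using n2 t (Ioi_subset_Ici_self ht) _ (hb' t)
      refine (add_le_add a b).trans (le_of_eq ?_)
      rw [hhe]
      ring
    · intro t ht
      have ht0 : 0 < x * t := mul_pos hx (hN.trans_lt ht)
      have h1 : HasDerivAt (fun t : ℝ => x * t) x t := by
        simpa using (hasDerivAt_id t).const_mul x
      have h2 := ((hh_derivK _ ht0).comp t h1).div_const x
      have h3 : HasDerivAt (fun t : ℝ => hhK (x * t) / x) (hhk (x * t)) t :=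
        HasDerivAt.congr_deriv h2 (by field_simp)
      exact h3.ofReal_comp
    · refine I1.congr_fun (fun t _ => ?_) measurableSet_Ioi
      simp only [Pi.mul_apply]
      ring
    · have : Continuous (hhH f * fun t : ℝ => ((hhK (x * t) / x : ℝ) : ℂ)) := by fun_prop
      exact (this.tendsto N).mono_left nhdsWithin_le_nhds
    · have b : Tendsto (fun N : ℝ => C * B / x * (1 + N ^ 2)⁻¹) atTop (𝓝 0) := by
        simpa using (tendsto_inv_atTop_zero.comp (tendsto_atTop_add_const_left _ (1:ℝ)
          (tendsto_pow_atTop (α := ℝ) (n := 2) (by norm_num)))).const_mul (C * B / x)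
      refine squeeze_zero_norm' ?_ b
      filter_upwards [eventually_ge_atTop N] with t ht
      exact n2 t ht _ (hb t)

/-- Inversion of the half-Hartley transform: for `f` of class `C²` with compact support in
`(0,∞)` and `h = H₊f`, the truncated integrals
`F_N(x) = √(2/π) ∫₀^N [sin(xt) S(xt) + cos(xt) C(xt)] h(t) dt`
converge to `f` in the `L²(0,∞)` norm as `N → ∞`. -/
theorem halfHartley_inversion (f : ℝ → ℂ) (hf : ContDiff ℝ 2 f)
    (hsupp : HasCompactSupport f) (hpos : tsupport f ⊆ Ioi (0 : ℝ)) :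
    Tendsto (fun N : ℝ =>
        ∫ x in Ioi (0 : ℝ),
          ‖(Real.sqrt (2 / π) : ℂ) *
              (∫ t in Ioc (0 : ℝ) N,
                ((Real.sin (x * t) * fresnelS (x * t) +
                    Real.cos (x * t) * fresnelC (x * t) : ℝ) : ℂ) * halfHartley f t) -
            f x‖ ^ 2)
      atTop (𝓝 0) := by
  obtain ⟨D, hD⟩ := hh_tail f hf hsupp hpos
  have hbound : ∀ N : ℝ, 0 ≤ N → ∀ x : ℝ, 0 < x →
      ‖(Real.sqrt (2 / π) : ℂ) *
              (∫ t in Ioc (0 : ℝ) N,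
                ((Real.sin (x * t) * fresnelS (x * t) +
                    Real.cos (x * t) * fresnelC (x * t) : ℝ) : ℂ) * halfHartley f t) -
            f x‖ ^ 2 ≤ (2 / π * (D * hhe N)) ^ 2 * 2 * (1 + x ^ 2)⁻¹ := by
    intro N hN x hx
    obtain ⟨-, b1, b2⟩ := hD x N hx hN
    have I0 := (hD x 0 hx le_rfl).1
    have pw := hh_pointwise_s6 f hf hsupp hpos x hx
    have e1 : ∫ t in Ioc (0 : ℝ) N, ((Real.sin (x * t) * fresnelS (x * t) +
        Real.cos (x * t) * fresnelC (x * t) : ℝ) : ℂ) * halfHartley f t =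
        (√(2 / π) : ℂ) * ∫ t in Ioc (0 : ℝ) N, ((hhk (x * t) : ℝ) : ℂ) * hhH f t := by
      rw [← integral_const_mul]
      refine integral_congr_ae (Eventually.of_forall fun t => ?_)
      simp only [halfHartley, hhk, hhH]
      ring
    have hsq : (√(2 / π) : ℂ) * (√(2 / π) : ℂ) = 2 / π := by
      rw [← Complex.ofReal_mul, Real.mul_self_sqrt (by positivity)]
      push_cast
      rfl
    have hpi : (π : ℂ) ≠ 0 := by exact_mod_cast Real.pi_ne_zero
    have split : ∫ t in Ioi (0:ℝ), ((hhk (x * t) : ℝ) : ℂ) * hhH f t =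
        (∫ t in Ioc (0 : ℝ) N, ((hhk (x * t) : ℝ) : ℂ) * hhH f t) +
          ∫ t in Ioi N, ((hhk (x * t) : ℝ) : ℂ) * hhH f t := by
      rw [← Ioc_union_Ioi_eq_Ioi hN]
      refine setIntegral_union (Ioc_disjoint_Ioi le_rfl) measurableSet_Ioi ?_ ?_
      · exact I0.mono_set Ioc_subset_Ioi_self
      · exact I0.mono_set (Ioi_subset_Ioi hN)
    have e2 : (Real.sqrt (2 / π) : ℂ) *
              (∫ t in Ioc (0 : ℝ) N,
                ((Real.sin (x * t) * fresnelS (x * t) +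
                    Real.cos (x * t) * fresnelC (x * t) : ℝ) : ℂ) * halfHartley f t) -
            f x = -(((2 / π : ℝ) : ℂ) * ∫ t in Ioi N, ((hhk (x * t) : ℝ) : ℂ) * hhH f t) := by
      rw [e1, ← mul_assoc, hsq]
      have : f x = (2 / π : ℂ) * ((π / 2 : ℂ) * f x) := by field_simp
      rw [this, ← pw, split]
      push_cast
      ring
    rw [e2, norm_neg, norm_mul, Complex.norm_real, Real.norm_of_nonneg (by positivity)]
    have hT := norm_nonneg (∫ t in Ioi N, ((hhk (x * t) : ℝ) : ℂ) * hhH f t)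
    generalize ‖∫ t in Ioi N, ((hhk (x * t) : ℝ) : ℂ) * hhH f t‖ = T at b1 b2 hT ⊢
    generalize D * hhe N = d at b1 b2 ⊢
    rw [le_div_iff₀ hx] at b2
    have c1 : T ^ 2 ≤ d ^ 2 := pow_le_pow_left₀ hT b1 2
    have c2 : (T * x) ^ 2 ≤ d ^ 2 := pow_le_pow_left₀ (by positivity) b2 2
    rw [← div_eq_mul_inv, le_div_iff₀ (by positivity), mul_pow, mul_pow]
    have c3 : T ^ 2 * (1 + x ^ 2) ≤ d ^ 2 * 2 := by nlinarith
    have := mul_le_mul_of_nonneg_left c3 (sq_nonneg (2 / π))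
    linarith
  have hlim : Tendsto (fun N : ℝ => (2 / π * (D * hhe N)) ^ 2 * 2 * ∫ x in Ioi (0:ℝ), (1 + x ^ 2)⁻¹)
      atTop (𝓝 0) := by
    have := ((((hhe_tendsto.const_mul D).const_mul (2 / π)).pow 2).mul_const 2).mul_const
      (∫ x in Ioi (0:ℝ), (1 + x ^ 2)⁻¹)
    simpa using this
  refine squeeze_zero' (Eventually.of_forall fun N => integral_nonneg fun x => by positivity) ?_ hlim
  filter_upwards [eventually_ge_atTop 0] with N hN
  rw [← integral_const_mul]
  refine integral_mono_of_nonneg (Eventually.of_forall fun x => by positivity)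
    (integrable_inv_one_add_sq.const_mul _).integrableOn ?_
  filter_upwards [ae_restrict_mem measurableSet_Ioi] with x hx using hbound N hN x hx
end

section
/- For every s ∈ ℂ with Re s = 1/2, the improper integral lim_{R→∞} ∫₀^R (sin t) t^{s−2} dt exists and equals Γ(s) cos(πs/2)/(1 − s). -/
open MeasureTheory Set Filter
open scoped Real Topology

lemma aux_meas (a z : ℂ) : ContinuousOn (fun t : ℝ => (t:ℂ) ^ a * Complex.exp (-(z * t))) (Ioi 0) := by
  intro t ht
  have ht : 0 < t := ht
  apply ContinuousAt.continuousWithinAt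
  apply ContinuousAt.mul
  · exact Complex.continuousAt_ofReal_cpow_const _ _ (Or.inr ht.ne')
  · fun_prop

lemma aux_norm (a z : ℂ) {t : ℝ} (ht : 0 < t) :
    ‖(t:ℂ) ^ a * Complex.exp (-(z * t))‖ = t ^ a.re * Real.exp (-(z.re * t)) := by
  rw [norm_mul, Complex.norm_cpow_eq_rpow_re_of_pos ht, Complex.norm_exp]
  simp

lemma aux_intR {c b : ℝ} (hc : -1 < c) (hb : 0 < b) :
    IntegrableOn (fun t : ℝ => t ^ c * Real.exp (-(b * t))) (Ioi 0) := by
  have := integrableOn_rpow_mul_exp_neg_mul_rpow (p := 1) hc one_pos hb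
  simpa using this

lemma aux_int {a z : ℂ} (ha : -1 < a.re) (hz : 0 < z.re) :
    IntegrableOn (fun t : ℝ => (t:ℂ) ^ a * Complex.exp (-(z * t))) (Ioi 0) := by
  refine Integrable.mono' (aux_intR ha hz)
    ((aux_meas a z).aestronglyMeasurable measurableSet_Ioi) ?_
  filter_upwards [ae_restrict_mem measurableSet_Ioi] with t ht
  exact (aux_norm a z ht).le

lemma aux_diff {a z : ℂ} (ha : -1 < a.re) (hz : 0 < z.re) :
    DifferentiableAt ℂ (fun z => ∫ t in Ioi (0:ℝ), (t:ℂ) ^ a * Complex.exp (-(z * t))) z := by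
  have key := hasDerivAt_integral_of_dominated_loc_of_deriv_le
    (μ := volume.restrict (Ioi (0:ℝ))) (𝕜 := ℂ) (x₀ := z) (s := {w : ℂ | z.re / 2 < w.re})
    (F := fun w (t:ℝ) => (t:ℂ) ^ a * Complex.exp (-(w * t)))
    (F' := fun w (t:ℝ) => (t:ℂ) ^ a * (Complex.exp (-(w * t)) * (-t)))
    (bound := fun t => t ^ (a.re + 1) * Real.exp (-(z.re / 2 * t)))
    ?_ ?_ (aux_int ha hz) ?_ ?_ (aux_intR (by linarith) (by linarith)) ?_
  · exact key.2.differentiableAt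
  · exact (isOpen_lt continuous_const Complex.continuous_re).mem_nhds (by simp; linarith)
  · exact Eventually.of_forall fun w => (aux_meas a w).aestronglyMeasurable measurableSet_Ioi
  · refine ContinuousOn.aestronglyMeasurable ?_ measurableSet_Ioi
    simp_rw [← mul_assoc]
    exact (aux_meas a z).mul (by fun_prop)
  · filter_upwards [ae_restrict_mem measurableSet_Ioi] with t ht w hw
    have ht : 0 < t := ht
    have hw : z.re / 2 < w.re := hw
    rw [← mul_assoc, norm_mul, aux_norm a w ht, Real.rpow_add ht, Real.rpow_one, norm_neg,
      Complex.norm_real, Real.norm_of_nonneg ht.le, mul_right_comm]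
    gcongr
  · refine Eventually.of_forall fun t w _ => ?_
    refine HasDerivAt.const_mul _ ?_
    apply HasDerivAt.cexp
    simpa using ((hasDerivAt_id w).mul_const (t:ℂ)).fun_neg

lemma aux_gamma {s z : ℂ} (hs : 0 < s.re) (hz : 0 < z.re) :
    ∫ t in Ioi (0:ℝ), (t:ℂ) ^ (s - 1) * Complex.exp (-(z * t)) = (1 / z) ^ s * Complex.Gamma s := by
  have ho : IsOpen {w : ℂ | 0 < w.re} := isOpen_lt continuous_const Complex.continuous_re
  have h1 : AnalyticOnNhd ℂ
      (fun z => ∫ t in Ioi (0:ℝ), (t:ℂ) ^ (s - 1) * Complex.exp (-(z * t))) {w : ℂ | 0 < w.re} :=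
    DifferentiableOn.analyticOnNhd
      (fun w hw => (aux_diff (by simp; linarith) hw).differentiableWithinAt) ho
  have h2 : AnalyticOnNhd ℂ (fun z : ℂ => (1 / z) ^ s * Complex.Gamma s) {w : ℂ | 0 < w.re} := by
    refine DifferentiableOn.analyticOnNhd (fun w hw => DifferentiableAt.differentiableWithinAt ?_) ho
    have hw : 0 < w.re := hw
    have hw0 : w ≠ 0 := by rintro rfl; simp at hw
    refine DifferentiableAt.mul_const (DifferentiableAt.cpow_const (by fun_prop (disch := exact hw0)) ?_) _
    left
    rw [one_div, Complex.inv_re]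
    exact div_pos hw (Complex.normSq_pos.2 hw0)
  refine h1.eqOn_of_preconnected_of_frequently_eq h2
    (convex_halfSpace_re_gt 0).isPreconnected (z₀ := 1) (by simp) ?_ hz
  have ht : Tendsto (fun x : ℝ => (x:ℂ)) (𝓝[≠] 1) (𝓝[≠] 1) := by
    refine tendsto_nhdsWithin_of_tendsto_nhds_of_eventually_within _ ?_ ?_
    · exact ((Complex.continuous_ofReal.tendsto' 1 1 (by simp))).mono_left nhdsWithin_le_nhds
    · filter_upwards [self_mem_nhdsWithin] with x hx
      simpa using hx
  refine ht.frequently (Eventually.frequently ?_)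
  filter_upwards [nhdsWithin_le_nhds (lt_mem_nhds (zero_lt_one))] with x hx
  exact Complex.integral_cpow_mul_exp_neg_mul_Ioi hs hx

lemma aux_sin (ε t : ℝ) : Complex.exp (-((ε - Complex.I) * t)) - Complex.exp (-((ε + Complex.I) * t))
    = 2 * Complex.I * (((Real.sin t : ℝ) : ℂ) * Complex.exp (-(ε * t))) := by
  have e1 : -(((ε:ℂ) - Complex.I) * t) = -(ε * t) + t * Complex.I := by ring
  have e2 : -(((ε:ℂ) + Complex.I) * t) = -(ε * t) + -t * Complex.I := by ring
  rw [e1, e2, Complex.exp_add, Complex.exp_add, Complex.ofReal_sin, Complex.sin]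
  linear_combination (Complex.exp (-(ε * t)) * (Complex.exp (t * Complex.I) - Complex.exp (-t * Complex.I))) * Complex.I_sq

lemma aux_cont (s : ℂ) : ContinuousOn (fun t : ℝ => ((Real.sin t : ℝ) : ℂ) * (t:ℂ) ^ (s - 2)) (Ioi 0) := by
  intro t ht
  have ht : 0 < t := ht
  apply ContinuousAt.continuousWithinAt
  apply ContinuousAt.mul
  · fun_prop
  · exact Complex.continuousAt_ofReal_cpow_const _ _ (Or.inr ht.ne')

lemma aux_f_int (s : ℂ) (hs : s.re = 1 / 2) :
    IntegrableOn (fun t : ℝ => ((Real.sin t : ℝ) : ℂ) * (t:ℂ) ^ (s - 2)) (Ioi 0) := by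
  have hn : ∀ t : ℝ, 0 < t → ‖((Real.sin t : ℝ) : ℂ) * (t:ℂ) ^ (s - 2)‖ = |Real.sin t| * t ^ (-(3/2) : ℝ) := by
    intro t ht
    rw [norm_mul, Complex.norm_cpow_eq_rpow_re_of_pos ht, Complex.norm_real, Real.norm_eq_abs]
    congr 2
    simp [hs]; norm_num
  rw [← Ioc_union_Ioi_eq_Ioi (zero_le_one (α := ℝ)), integrableOn_union]
  constructor
  · have h := (intervalIntegrable_iff_integrableOn_Ioc_of_le (μ := volume) (zero_le_one (α := ℝ))).1
      (intervalIntegral.intervalIntegrable_rpow' (r := -(1/2)) (by norm_num))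
    refine Integrable.mono' h
      (((aux_cont s).mono Ioc_subset_Ioi_self).aestronglyMeasurable measurableSet_Ioc) ?_
    filter_upwards [ae_restrict_mem measurableSet_Ioc] with t ht
    have h0 : 0 < t := ht.1
    rw [hn t h0]
    calc |Real.sin t| * t ^ (-(3/2) : ℝ) ≤ t * t ^ (-(3/2) : ℝ) := by
          gcongr
          exact (Real.abs_sin_le_abs).trans (abs_of_pos h0).le
      _ = t ^ (-(1/2) : ℝ) := by
          nth_rw 1 [← Real.rpow_one t]
          rw [← Real.rpow_add h0]; norm_num
  · have h := integrableOn_Ioi_rpow_of_lt (a := -(3/2)) (c := 1) (by norm_num) one_pos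
    refine Integrable.mono' h
      (((aux_cont s).mono (Ioi_subset_Ioi zero_le_one)).aestronglyMeasurable measurableSet_Ioi) ?_
    filter_upwards [ae_restrict_mem measurableSet_Ioi] with t ht
    have h0 : 0 < t := one_pos.trans ht
    rw [hn t h0]
    exact mul_le_of_le_one_left (by positivity) (Real.abs_sin_le_one t)

lemma aux_fe_norm {ε t : ℝ} (he : 0 < ε) (ht : 0 < t) : ‖Complex.exp (-((ε:ℂ) * t))‖ ≤ 1 := by
  rw [Complex.norm_exp, Real.exp_le_one_iff]
  simp; positivity

lemma aux_fe_int (s : ℂ) (hs : s.re = 1 / 2) {ε : ℝ} (he : 0 < ε) :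
    IntegrableOn (fun t : ℝ => ((Real.sin t : ℝ) : ℂ) * (t:ℂ) ^ (s - 2) * Complex.exp (-(ε * t)))
      (Ioi 0) := by
  refine Integrable.mono (aux_f_int s hs)
    (((aux_cont s).mul (by fun_prop)).aestronglyMeasurable measurableSet_Ioi) ?_
  filter_upwards [ae_restrict_mem measurableSet_Ioi] with t ht
  rw [norm_mul]
  exact mul_le_of_le_one_right (norm_nonneg _) (aux_fe_norm he ht)

lemma aux_ibp (s : ℂ) (hs : s.re = 1 / 2) {ε : ℝ} (he : 0 < ε) :
    ∫ t in Ioi (0:ℝ), ((Real.sin t : ℝ) : ℂ) * (t:ℂ) ^ (s - 2) * Complex.exp (-(ε * t)) =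
      Complex.Gamma s * ((ε - Complex.I) * (1 / (ε - Complex.I)) ^ s
        - (ε + Complex.I) * (1 / (ε + Complex.I)) ^ s) / (2 * Complex.I) / (s - 1) := by
  have hs1 : s - 1 ≠ 0 := by
    intro h
    have := congrArg Complex.re h
    simp [hs] at this; norm_num at this
  set p : ℂ := ε - Complex.I with hp
  set q : ℂ := ε + Complex.I with hq
  have hpr : 0 < p.re := by simp [hp, he]
  have hqr : 0 < q.re := by simp [hq, he]
  have hsr : 0 < s.re := by rw [hs]; norm_num
  have hsr' : -1 < (s - 1).re := by simp [hs]
  have ip := aux_int hsr' hpr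
  have iq := aux_int hsr' hqr
  have iF := aux_fe_int s hs he
  have hI : (2 * Complex.I) ≠ 0 := by simp
  have hHn : ∀ t : ℝ, 0 ≤ t → ‖((Real.sin t : ℝ) : ℂ) * Complex.exp (-(ε * t)) * (t:ℂ) ^ (s - 1)‖
      ≤ |Real.sin t| * t ^ (-(1/2) : ℝ) := by
    intro t ht
    rcases ht.eq_or_lt with rfl | ht
    · simp
    rw [norm_mul, norm_mul, Complex.norm_cpow_eq_rpow_re_of_pos ht, Complex.norm_real, Real.norm_eq_abs]
    have : (s - 1).re = -(1/2) := by simp [hs]; norm_num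
    rw [this]
    gcongr
    exact mul_le_of_le_one_right (abs_nonneg _) (aux_fe_norm he ht)
  have key := integral_Ioi_of_hasDerivAt_of_tendsto (a := (0:ℝ)) (m := (0:ℂ))
    (f := fun t : ℝ => ((Real.sin t : ℝ) : ℂ) * Complex.exp (-(ε * t)) * (t:ℂ) ^ (s - 1))
    (f' := fun t : ℝ => (-p / (2 * Complex.I)) * ((t:ℂ) ^ (s - 1) * Complex.exp (-(p * t)))
      + (q / (2 * Complex.I)) * ((t:ℂ) ^ (s - 1) * Complex.exp (-(q * t)))
      + (s - 1) * (((Real.sin t : ℝ) : ℂ) * (t:ℂ) ^ (s - 2) * Complex.exp (-(ε * t))))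
    ?_ ?_ (((ip.const_mul _).add (iq.const_mul _)).add (iF.const_mul _)) ?_
  · rw [integral_add (Integrable.fun_add (ip.const_mul _) (iq.const_mul _)) (iF.const_mul _),
      integral_add (ip.const_mul _) (iq.const_mul _), integral_const_mul, integral_const_mul,
      integral_const_mul, aux_gamma hsr hpr, aux_gamma hsr hqr] at key
    simp only [Real.sin_zero, Complex.ofReal_zero, zero_mul, sub_zero] at key
    rw [eq_div_iff hs1]
    linear_combination key
  · have h0 : Tendsto (fun t : ℝ => t ^ (1/2 : ℝ)) (𝓝[Ici 0] 0) (𝓝 0) := by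
      have : ContinuousAt (fun t : ℝ => t ^ (1/2 : ℝ)) 0 :=
        Real.continuousAt_rpow_const _ _ (Or.inr (by norm_num))
      have h := this.tendsto
      rw [Real.zero_rpow (by norm_num)] at h
      exact h.mono_left nhdsWithin_le_nhds
    unfold ContinuousWithinAt
    simp only [Real.sin_zero, Complex.ofReal_zero, zero_mul]
    refine squeeze_zero_norm' ?_ h0
    filter_upwards [self_mem_nhdsWithin] with t ht
    have ht : 0 ≤ t := ht
    refine (hHn t ht).trans ?_
    rcases ht.eq_or_lt with rfl | ht
    · simp
    calc |Real.sin t| * t ^ (-(1/2) : ℝ) ≤ t * t ^ (-(1/2) : ℝ) := by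
          gcongr
          exact (Real.abs_sin_le_abs).trans (abs_of_pos ht).le
      _ = t ^ ((1/2) : ℝ) := by
          nth_rw 1 [← Real.rpow_one t]
          rw [← Real.rpow_add ht]; norm_num
  · intro t ht
    have ht : 0 < t := ht
    have hd : ∀ z : ℂ, HasDerivAt (fun t : ℝ => Complex.exp (-(z * t)))
        (Complex.exp (-(z * t)) * (-z)) t := by
      intro z
      apply HasDerivAt.cexp
      simpa using ((Complex.ofRealCLM.hasDerivAt (x := t)).const_mul z).fun_neg
    have h1 := (((hd p).sub (hd q)).div_const (2 * Complex.I)).mul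
      (hasDerivAt_ofReal_cpow_const ht.ne' hs1)
    have es : ∀ t : ℝ, (Complex.exp (-(p * t)) - Complex.exp (-(q * t))) / (2 * Complex.I)
        = ((Real.sin t : ℝ) : ℂ) * Complex.exp (-(ε * t)) := by
      intro t
      rw [aux_sin, mul_div_cancel_left₀ _ hI]
    convert! h1 using 1
    · funext t
      simp only [Pi.mul_apply, Pi.sub_apply]
      rw [es]
    · simp only [Pi.sub_apply]
      rw [es, show s - 1 - 1 = s - 2 by ring]
      ring
  · refine squeeze_zero_norm' ?_ (tendsto_rpow_neg_atTop (y := 1/2) (by norm_num))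
    filter_upwards [eventually_ge_atTop 0] with t ht
    refine (hHn t ht).trans ?_
    exact mul_le_of_le_one_left (by positivity) (Real.abs_sin_le_one t)

/-- Mellin transform of `sin t / t` on the critical line: the improper integral
`lim_{R→∞} ∫₀^R (sin t) t^{s-2} dt` exists and equals `Γ(s) cos(πs/2)/(1-s)`. -/
theorem mellin_sin_div_self (s : ℂ) (hs : s.re = 1 / 2) :
    Tendsto (fun R : ℝ => ∫ t in Ioc (0 : ℝ) R, ((Real.sin t : ℝ) : ℂ) * (t : ℂ) ^ (s - 2))
      atTop (𝓝 (Complex.Gamma s * Complex.cos (π * s / 2) / (1 - s))) := by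
  have hs1 : s - 1 ≠ 0 := by
    intro h
    have := congrArg Complex.re h
    simp [hs] at this; norm_num at this
  have hs2 : 1 - s ≠ 0 := by
    intro h; apply hs1; linear_combination -h
  have hL1 : Tendsto (fun ε : ℝ => ∫ t in Ioi (0:ℝ),
      ((Real.sin t : ℝ) : ℂ) * (t:ℂ) ^ (s - 2) * Complex.exp (-(ε * t))) (𝓝[>] 0)
      (𝓝 (∫ t in Ioi (0:ℝ), ((Real.sin t : ℝ) : ℂ) * (t:ℂ) ^ (s - 2))) := by
    refine tendsto_integral_filter_of_dominated_convergence
      (fun t : ℝ => ‖((Real.sin t : ℝ) : ℂ) * (t:ℂ) ^ (s - 2)‖) ?_ ?_ (aux_f_int s hs).norm ?_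
    · filter_upwards [self_mem_nhdsWithin] with ε he
      exact (aux_fe_int s hs he).aestronglyMeasurable
    · filter_upwards [self_mem_nhdsWithin] with ε he
      filter_upwards [ae_restrict_mem measurableSet_Ioi] with t ht
      rw [norm_mul]
      exact mul_le_of_le_one_right (norm_nonneg _) (aux_fe_norm he ht)
    · refine Eventually.of_forall fun t => ?_
      refine Tendsto.mono_left (Continuous.tendsto' ?_ _ _ ?_) nhdsWithin_le_nhds
      · fun_prop
      · simp
  have hL2 : Tendsto (fun ε : ℝ => Complex.Gamma s * ((ε - Complex.I) * (1 / (ε - Complex.I)) ^ s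
        - (ε + Complex.I) * (1 / (ε + Complex.I)) ^ s) / (2 * Complex.I) / (s - 1)) (𝓝[>] 0)
      (𝓝 (Complex.Gamma s * Complex.cos (π * s / 2) / (1 - s))) := by
    have hc : ContinuousAt (fun ε : ℝ => Complex.Gamma s * ((ε - Complex.I) * (1 / (ε - Complex.I)) ^ s
        - (ε + Complex.I) * (1 / (ε + Complex.I)) ^ s) / (2 * Complex.I) / (s - 1)) 0 := by
      have a1 : ContinuousAt (fun ε : ℝ => (1 / ((ε:ℂ) - Complex.I))) 0 :=
        ContinuousAt.div (by fun_prop) (by fun_prop) (by simp)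
      have a2 : ContinuousAt (fun ε : ℝ => (1 / ((ε:ℂ) + Complex.I))) 0 :=
        ContinuousAt.div (by fun_prop) (by fun_prop) (by simp)
      have b1 := a1.cpow (continuousAt_const (y := s)) (by right; simp)
      have b2 := a2.cpow (continuousAt_const (y := s)) (by right; simp)
      refine ContinuousAt.div_const (ContinuousAt.div_const (continuousAt_const.mul ?_) _) _
      exact (ContinuousAt.mul (by fun_prop) b1).sub (ContinuousAt.mul (by fun_prop) b2)
    have h := hc.tendsto.mono_left (nhdsWithin_le_nhds (s := Ioi (0:ℝ)))
    convert h using 2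
    have c1 : (1 / (((0:ℝ):ℂ) - Complex.I)) = Complex.I := by simp
    have c2 : (1 / (((0:ℝ):ℂ) + Complex.I)) = -Complex.I := by simp
    rw [c1, c2, Complex.cpow_def_of_ne_zero Complex.I_ne_zero,
      Complex.cpow_def_of_ne_zero (neg_ne_zero.2 Complex.I_ne_zero), Complex.log_I,
      Complex.log_neg_I, Complex.cos]
    have d1 : (π:ℂ) * s / 2 * Complex.I = π / 2 * Complex.I * s := by ring
    have d2 : -((π:ℂ) * s / 2) * Complex.I = -(π / 2) * Complex.I * s := by ring
    rw [d1, d2]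
    have hI := Complex.I_ne_zero
    rw [show 1 - s = -(s - 1) by ring]
    push_cast
    field_simp
    ring
  have hval := tendsto_nhds_unique hL1 (hL2.congr' (by
    filter_upwards [self_mem_nhdsWithin] with ε he
    exact (aux_ibp s hs he).symm))
  rw [← hval]
  refine (intervalIntegral_tendsto_integral_Ioi 0 (aux_f_int s hs) tendsto_id).congr' ?_
  filter_upwards [eventually_ge_atTop 0] with R hR
  exact intervalIntegral.integral_of_le hR
end
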